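/- arXiv:1005.2863 — 3 statements merged into one kernel-verified Lean document; each statement's English description precedes it below -/
import Mathlib

section
/- For every C > 0 and every δ > 0 there exist T and N such that for all n ≥ N and all integers t with T ≤ t ≤ ⌈C·log n⌉: |X0(n,t)| < 2^{(0.6·log 3 + δ)·t·n}·F(n−t). (All logarithms are base 2.) -/
open Filter

noncomputable section

/-- A colored graph on `Fin n`: a simple graph whose edges are partitioned
into red and blue edges. -/
structure ColoredGraph (n : ℕ) where
  red : SimpleGraph (Fin n)
  blue : SimpleGraph (Fin n)
  disj : ∀ x y, ¬ (red.Adj x y ∧ blue.Adj x y)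

namespace ColoredGraph

variable {n : ℕ}

/-- The underlying (uncolored) simple graph. -/
def graph (G : ColoredGraph n) : SimpleGraph (Fin n) := G.red ⊔ G.blue

/-- Adjacency in a colored graph. -/
def Adj (G : ColoredGraph n) (x y : Fin n) : Prop := G.graph.Adj x y

/-- The neighborhood of a vertex. -/
def nbhd (G : ColoredGraph n) (x : Fin n) : Set (Fin n) := {y | G.Adj x y}

/-- `Γ(Q)`, the external neighborhood of a set of vertices. -/
def nbhdSet (G : ColoredGraph n) (Q : Set (Fin n)) : Set (Fin n) :=
  (⋃ x ∈ Q, G.nbhd x) \ Q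

/-- The degree of a vertex. -/
def deg (G : ColoredGraph n) (x : Fin n) : ℕ := (G.nbhd x).ncard

open scoped Classical in
/-- Indicator that the edge `xy` is blue. -/
def blueInd (G : ColoredGraph n) (x y : Fin n) : ℕ := if G.blue.Adj x y then 1 else 0

/-- Odd-blue-triangle-free: no triangle with an odd number of blue edges. -/
def OBTF (G : ColoredGraph n) : Prop :=
  ∀ x y z : Fin n, G.Adj x y → G.Adj y z → G.Adj x z →
    ¬ Odd (G.blueInd x y + G.blueInd y z + G.blueInd x z)

/-- The colored graph induced on the vertex set `A` is blue-bipartite: there is a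
partition `U ⊔ (A \ U)` of `A` such that blue edges within `A` cross the partition
and red edges within `A` do not. -/
def BlueBipartiteOn (G : ColoredGraph n) (A : Set (Fin n)) : Prop :=
  ∃ U ⊆ A, ∀ x ∈ A, ∀ y ∈ A,
    (G.blue.Adj x y → (x ∈ U ↔ y ∉ U)) ∧ (G.red.Adj x y → (x ∈ U ↔ y ∈ U))

/-- Blue-bipartite colored graph. -/
def BlueBipartite (G : ColoredGraph n) : Prop := G.BlueBipartiteOn Set.univ

/-- `κ(G)`: the minimum size of a vertex set whose removal leaves a blue-bipartite graph. -/
def kappa (G : ColoredGraph n) : ℕ :=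
  sInf {k | ∃ K : Set (Fin n), K.ncard = k ∧ G.BlueBipartiteOn Kᶜ}

end ColoredGraph

/-- `𝓕(n)`: the set of OBTF colored graphs on `[n]`. -/
def obtfSet (n : ℕ) : Set (ColoredGraph n) := {G | G.OBTF}

/-- `F(n) = |𝓕(n)|`. -/
def Fnum (n : ℕ) : ℕ := (obtfSet n).ncard

/-- `𝓑(n)`: the set of blue-bipartite colored graphs on `[n]`. -/
def bbSet (n : ℕ) : Set (ColoredGraph n) := {G | G.BlueBipartite}

/-- `|𝓑(n)|`. -/
def Bnum (n : ℕ) : ℕ := (bbSet n).ncard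

/-- `b(n) = 2^{n(n+1)/2 - 1}`. -/
def bnum (n : ℕ) : ℕ := 2 ^ (n * (n + 1) / 2 - 1)

/-- `X0(n,t)`: OBTF graphs on `[n]` having a `t`-set of vertices `Q` with
`|Γ(Q)| < 0.6 n`. -/
def X0set (n t : ℕ) : Set (ColoredGraph n) :=
  {G ∈ obtfSet n | ∃ Q : Set (Fin n), Q.ncard = t ∧ ((G.nbhdSet Q).ncard : ℝ) < 0.6 * n}

namespace ColoredGraph

theorem ext_adj {n : ℕ} {G H : ColoredGraph n}
    (h : ∀ x y, (G.red.Adj x y ↔ H.red.Adj x y) ∧ (G.blue.Adj x y ↔ H.blue.Adj x y)) : G = H := by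
  obtain ⟨r, b, d⟩ := G
  obtain ⟨r', b', d'⟩ := H
  have h1 : r = r' := by
    ext x y; exact (h x y).1
  have h2 : b = b' := by
    ext x y; exact (h x y).2
  subst h1; subst h2; rfl

instance instFiniteColoredGraph (n : ℕ) : Finite (ColoredGraph n) := by
  refine Finite.of_injective (β := SimpleGraph (Fin n) × SimpleGraph (Fin n))
    (fun G => (G.red, G.blue)) ?_
  intro G H h
  simp only [Prod.mk.injEq] at h
  apply ext_adj
  intro x y
  rw [h.1, h.2]
  exact ⟨Iff.rfl, Iff.rfl⟩

/-- Pull back a colored graph along an embedding. -/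
def pull {m n : ℕ} (e : Fin m ↪ Fin n) (G : ColoredGraph n) : ColoredGraph m where
  red := G.red.comap e
  blue := G.blue.comap e
  disj := fun x y => G.disj (e x) (e y)

theorem pull_obtf {m n : ℕ} (e : Fin m ↪ Fin n) (G : ColoredGraph n) (h : G.OBTF) :
    (pull e G).OBTF := by
  intro x y z h1 h2 h3
  exact h (e x) (e y) (e z) h1 h2 h3

open scoped Classical in
/-- The color of a pair. -/
def col {n : ℕ} (G : ColoredGraph n) (x y : Fin n) : Fin 3 :=
  if G.red.Adj x y then 1 else if G.blue.Adj x y then 2 else 0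

theorem col_eq {n : ℕ} {G H : ColoredGraph n} {x y : Fin n} (h : G.col x y = H.col x y) :
    (G.red.Adj x y ↔ H.red.Adj x y) ∧ (G.blue.Adj x y ↔ H.blue.Adj x y) := by
  have hG := G.disj x y
  have hH := H.disj x y
  unfold col at h
  by_cases a : G.red.Adj x y <;> by_cases b : H.red.Adj x y <;>
    by_cases c : G.blue.Adj x y <;> by_cases d : H.blue.Adj x y <;> simp_all

end ColoredGraph

open ColoredGraph

/-- OBTF graphs with prescribed external neighborhood. -/
def Sset (n : ℕ) (Q W : Finset (Fin n)) : Set (ColoredGraph n) :=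
  {G ∈ obtfSet n | G.nbhdSet (Q : Set (Fin n)) = (W : Set (Fin n))}

theorem Sset_card (n t : ℕ) (Q W : Finset (Fin n)) (hQ : Q.card = t) :
    (Sset n Q W).ncard ≤ Fnum (n - t) * 3 ^ (t * (t + W.card)) := by
  classical
  have hc : (Qᶜ).card = n - t := by rw [Finset.card_compl, hQ, Fintype.card_fin]
  let e : Fin (n - t) ↪ Fin n := ((Qᶜ).orderEmbOfFin hc).toEmbedding
  have he : ∀ x, x ∉ Q → ∃ i, e i = x := by
    intro x hx
    have : x ∈ Set.range ((Qᶜ).orderEmbOfFin hc) := by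
      rw [Finset.range_orderEmbOfFin]; simpa using hx
    exact this
  let f : ColoredGraph n → ColoredGraph (n - t) × ((Q × (Q ∪ W : Finset (Fin n))) → Fin 3) :=
    fun G => (pull e G, fun p => G.col p.1 p.2)
  have key : (Sset n Q W).ncard ≤ ((obtfSet (n - t)) ×ˢ
      (Set.univ : Set ((Q × (Q ∪ W : Finset (Fin n))) → Fin 3))).ncard := by
    refine Set.ncard_le_ncard_of_injOn f ?_ ?_ (Set.toFinite _)
    · intro G hG
      exact ⟨pull_obtf e G hG.1, trivial⟩
    · intro G hG H hH hf
      simp only [f, Prod.mk.injEq] at hf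
      obtain ⟨hf1, hf2⟩ := hf
      have out : ∀ K ∈ Sset n Q W, ∀ x y, x ∈ Q → y ∉ Q ∪ W →
          ¬ K.red.Adj x y ∧ ¬ K.blue.Adj x y := by
        intro K hK x y hx hy
        have hy' : y ∉ K.nbhdSet (Q : Set (Fin n)) := by
          rw [hK.2]; intro h; exact hy (Finset.mem_union_right _ h)
        have hyQ : y ∉ Q := fun h => hy (Finset.mem_union_left _ h)
        have hn : ¬ K.Adj x y := by
          intro h
          apply hy'
          refine ⟨?_, hyQ⟩
          simp only [Set.mem_iUnion]
          exact ⟨x, hx, h⟩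
        constructor
        · intro h; exact hn (Or.inl h)
        · intro h; exact hn (Or.inr h)
      have main : ∀ x y, x ∈ Q →
          (G.red.Adj x y ↔ H.red.Adj x y) ∧ (G.blue.Adj x y ↔ H.blue.Adj x y) := by
        intro x y hx
        by_cases hy : y ∈ Q ∪ W
        · exact col_eq (congrFun hf2 (⟨x, hx⟩, ⟨y, hy⟩))
        · have h1 := out G hG x y hx hy
          have h2 := out H hH x y hx hy
          tauto
      apply ext_adj
      intro x y
      by_cases hx : x ∈ Q
      · exact main x y hx
      by_cases hy : y ∈ Q
      · rw [G.red.adj_comm, H.red.adj_comm, G.blue.adj_comm, H.blue.adj_comm]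
        exact main y x hy
      obtain ⟨i, rfl⟩ := he x hx
      obtain ⟨j, rfl⟩ := he y hy
      have r1 : (pull e G).red.Adj i j ↔ (pull e H).red.Adj i j := by rw [hf1]
      have r2 : (pull e G).blue.Adj i j ↔ (pull e H).blue.Adj i j := by rw [hf1]
      exact ⟨r1, r2⟩
  refine key.trans ?_
  rw [Set.ncard_prod, Set.ncard_univ, Nat.card_fun]
  simp only [Nat.card_eq_fintype_card, Fintype.card_fin, Fintype.card_prod, Fintype.card_coe]
  refine Nat.mul_le_mul_left _ (Nat.pow_le_pow_right (by norm_num) ?_)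
  rw [hQ]
  refine Nat.mul_le_mul_left _ ((Finset.card_union_le _ _).trans ?_)
  rw [hQ]

theorem Fnum_pos (m : ℕ) : 0 < Fnum m := by
  unfold Fnum
  rw [Set.ncard_pos]
  refine ⟨⟨⊥, ⊥, by simp⟩, ?_⟩
  intro x y z h
  simp [ColoredGraph.Adj, ColoredGraph.graph] at h

theorem X0_bound (n t : ℕ) :
    ((X0set n t).ncard : ℝ) ≤
      (n : ℝ) ^ t * 2 ^ n * (Fnum (n - t) * (3 : ℝ) ^ ((t : ℝ) * (t + 0.6 * n))) := by
  classical
  let P : Finset (Finset (Fin n) × Finset (Fin n)) :=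
    (Finset.powersetCard t Finset.univ) ×ˢ
      (Finset.univ.filter fun W : Finset (Fin n) => (W.card : ℝ) < 0.6 * n)
  have hsub : X0set n t ⊆ ((P.biUnion fun p => (Set.toFinite (Sset n p.1 p.2)).toFinset :
      Finset (ColoredGraph n)) : Set (ColoredGraph n)) := by
    rintro G ⟨hG, Q, hQ, hW⟩
    simp only [Finset.coe_biUnion, Set.mem_iUnion]
    refine ⟨(Q.toFinset, (G.nbhdSet Q).toFinset), ?_, ?_⟩
    · simp only [P, Finset.coe_product, Set.mem_prod, Finset.mem_coe, Finset.mem_powersetCard,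
        Finset.mem_filter, Finset.mem_univ, true_and, Finset.subset_univ]
      rw [← Set.ncard_eq_toFinset_card', ← Set.ncard_eq_toFinset_card']
      exact ⟨hQ, hW⟩
    · simp only [Set.Finite.coe_toFinset]
      exact ⟨hG, by simp⟩
  have h1 : (X0set n t).ncard ≤ ∑ p ∈ P, (Sset n p.1 p.2).ncard := by
    refine (Set.ncard_le_ncard hsub (Set.toFinite _)).trans ?_
    rw [Set.ncard_coe_finset]
    refine Finset.card_biUnion_le.trans (Finset.sum_le_sum fun p _ => ?_)
    rw [Set.ncard_eq_toFinset_card]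
  have h2 : ((X0set n t).ncard : ℝ) ≤ ∑ p ∈ P, ((Sset n p.1 p.2).ncard : ℝ) := by
    exact_mod_cast h1
  have h3 : ∀ p ∈ P, ((Sset n p.1 p.2).ncard : ℝ) ≤
      Fnum (n - t) * (3 : ℝ) ^ ((t : ℝ) * (t + 0.6 * n)) := by
    rintro ⟨Q, W⟩ hp
    simp only [P, Finset.mem_product, Finset.mem_powersetCard,
        Finset.mem_filter, Finset.mem_univ, true_and, Finset.subset_univ] at hp
    have := Sset_card n t Q W hp.1
    have h' : ((Sset n Q W).ncard : ℝ) ≤ Fnum (n - t) * (3 : ℝ) ^ (t * (t + W.card)) := by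
      exact_mod_cast this
    refine h'.trans ?_
    refine mul_le_mul_of_nonneg_left ?_ (Nat.cast_nonneg _)
    rw [← Real.rpow_natCast]
    refine Real.rpow_le_rpow_of_exponent_le (by norm_num) ?_
    push_cast
    exact mul_le_mul_of_nonneg_left (by linarith [hp.2]) (Nat.cast_nonneg _)
  refine h2.trans ((Finset.sum_le_card_nsmul _ _ _ h3).trans ?_)
  rw [nsmul_eq_mul]
  refine mul_le_mul_of_nonneg_right ?_ (by positivity)
  have hP : P.card ≤ n ^ t * 2 ^ n := by
    rw [Finset.card_product, Finset.card_powersetCard, Finset.card_univ, Fintype.card_fin]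
    refine Nat.mul_le_mul (Nat.choose_le_pow n t) ((Finset.card_le_univ _).trans ?_)
    simp
  exact_mod_cast hP

theorem eventually_small (C δ : ℝ) (hC : 0 < C) (hδ : 0 < δ) :
    ∃ N : ℕ, ∀ n : ℕ, N ≤ n → 1 ≤ n ∧ Real.logb 2 n ≤ δ / 4 * n ∧
      2 * (C * Real.logb 2 n + 1) ≤ δ / 4 * n := by
  have hl : Tendsto (fun n : ℕ => Real.logb 2 n / (n : ℝ)) atTop (nhds 0) := by
    have h := (Real.isLittleO_log_id_atTop.tendsto_div_nhds_zero).comp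
      (tendsto_natCast_atTop_atTop (R := ℝ))
    have h2 := h.div_const (Real.log 2)
    rw [zero_div] at h2
    refine h2.congr fun n => ?_
    simp only [Function.comp, id, Real.logb]
    rw [div_right_comm]
  have hε : 0 < min (δ / 4) (δ / (16 * C)) := by positivity
  have e1 := hl.eventually (gt_mem_nhds hε)
  have e2 := (tendsto_natCast_atTop_atTop (R := ℝ)).eventually_ge_atTop (16 / δ)
  obtain ⟨N, hN⟩ := eventually_atTop.1 ((e1.and e2).and (eventually_ge_atTop 1))
  refine ⟨N, fun n hn => ?_⟩
  obtain ⟨⟨h1, h2⟩, h3⟩ := hN n hn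
  have hn0 : (0 : ℝ) < n := by exact_mod_cast h3
  have a1 := (div_lt_iff₀ hn0).1 (h1.trans_le (min_le_left _ _))
  have a2 := (div_lt_iff₀ hn0).1 (h1.trans_le (min_le_right _ _))
  refine ⟨h3, a1.le, ?_⟩
  have a3 : C * Real.logb 2 n ≤ δ / 16 * n := by
    calc C * Real.logb 2 n ≤ C * (δ / (16 * C) * n) := mul_le_mul_of_nonneg_left a2.le hC.le
      _ = δ / 16 * n := by field_simp
  have a4 : 16 ≤ n * δ := (div_le_iff₀ hδ).1 h2
  nlinarith

/-- Lemma 3.2: for every `C > 0` and `δ > 0`, for `n` large and `T ≤ t ≤ ⌈C log₂ n⌉`,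
`|X0(n,t)| < 2^{(0.6 log₂ 3 + δ) t n} F(n - t)`. -/
theorem X0_count (C δ : ℝ) (hC : 0 < C) (hδ : 0 < δ) :
    ∃ T N : ℕ, ∀ n : ℕ, N ≤ n → ∀ t : ℕ, T ≤ t → t ≤ ⌈C * Real.logb 2 n⌉₊ →
      ((X0set n t).ncard : ℝ) <
        (2 : ℝ) ^ ((0.6 * Real.logb 2 3 + δ) * t * n) * Fnum (n - t) := by
  obtain ⟨N, hN⟩ := eventually_small C δ hC hδ
  refine ⟨⌈4 / δ⌉₊ + 1, N, fun n hn t hT ht => ?_⟩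
  obtain ⟨h1, h2, h3⟩ := hN n hn
  have hn1 : (1 : ℝ) ≤ n := by exact_mod_cast h1
  have hn0 : (0 : ℝ) < n := by linarith
  have ht1 : (1 : ℝ) ≤ t := by
    have : 1 ≤ t := by omega
    exact_mod_cast this
  have htd : 4 / δ ≤ t := (Nat.le_ceil _).trans (by exact_mod_cast (by omega : ⌈4 / δ⌉₊ ≤ t))
  have htd' : 4 ≤ t * δ := (div_le_iff₀ hδ).1 htd
  have hl0 : 0 ≤ Real.logb 2 n := Real.logb_nonneg (by norm_num) hn1
  have htC : (t : ℝ) ≤ C * Real.logb 2 n + 1 :=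
    (Nat.cast_le.2 ht).trans (Nat.ceil_lt_add_one (by positivity)).le
  refine (X0_bound n t).trans_lt ?_
  have hF : (0 : ℝ) < Fnum (n - t) := by exact_mod_cast Fnum_pos _
  have e3 : (3 : ℝ) = 2 ^ Real.logb 2 3 := (Real.rpow_logb (by norm_num) (by norm_num) (by norm_num)).symm
  have en : (n : ℝ) = 2 ^ Real.logb 2 n := (Real.rpow_logb (by norm_num) (by norm_num) hn0).symm
  have hL : Real.logb 2 3 ≤ 2 := by
    rw [Real.logb_le_iff_le_rpow (by norm_num) (by norm_num)]
    norm_num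
  have p1 : (n : ℝ) ^ t = 2 ^ (Real.logb 2 n * t) := by
    rw [Real.rpow_mul (by norm_num), ← en, Real.rpow_natCast]
  have p2 : (3 : ℝ) ^ ((t : ℝ) * (t + 0.6 * n)) =
      2 ^ (Real.logb 2 3 * ((t : ℝ) * (t + 0.6 * n))) := by
    rw [Real.rpow_mul (x := 2) (by norm_num) (Real.logb 2 3), ← e3]
  have p3 : (2 : ℝ) ^ n = 2 ^ (n : ℝ) := (Real.rpow_natCast _ _).symm
  have hlt : Real.logb 2 n * t + n + Real.logb 2 3 * ((t : ℝ) * (t + 0.6 * n)) <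
      (0.6 * Real.logb 2 3 + δ) * t * n := by
    have b1 : Real.logb 2 n * t ≤ δ / 4 * n * t := mul_le_mul_of_nonneg_right h2 (by linarith)
    have b2 : 4 * (n : ℝ) ≤ t * δ * n := mul_le_mul_of_nonneg_right htd' hn0.le
    have b3 : Real.logb 2 3 * (t * t) ≤ 2 * (t * t) :=
      mul_le_mul_of_nonneg_right hL (by positivity)
    have b4 : (2 * t) * (t : ℝ) ≤ δ / 4 * n * t :=
      mul_le_mul_of_nonneg_right (by linarith) (by linarith)
    have b5 : 0 < δ * n * t := by positivity
    linarith
  have hpow := Real.rpow_lt_rpow_of_exponent_lt (x := 2) (by norm_num) hlt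
  rw [Real.rpow_add (by norm_num), Real.rpow_add (by norm_num), ← p1, ← p2, ← p3] at hpow
  calc _ = ((n : ℝ) ^ t * 2 ^ n * (3 : ℝ) ^ ((t : ℝ) * (t + 0.6 * n))) * Fnum (n - t) := by ring
    _ < _ := mul_lt_mul_of_pos_right hpow hF
end
end

section
/- For every ε ∈ (0,1/2) and every C > 0 there exists N such that for all n ≥ N the following holds. Let G ∈ 𝓕(n)∖X0(n), let K2(G) be any maximum collection as in the definition of κ2(G), let x ∈ [n]∖(K1(G)∪K2(G)), and let S ⊆ [n] with |S| ≤ 6s, where s = ⌈C·log n⌉. Then there exists Q_x ⊆ Γ(x)∖S with |Q_x| = ⌈log n⌉ and |[n]∖(K1(G)∪K2(G)∪Γ(Q_x))| ≤ 2·n^{1−ε}. (All logarithms are base 2.) -/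
open Filter

noncomputable section

/-- The binary entropy function (logarithms base 2). -/
def binH (x : ℝ) : ℝ := -x * Real.logb 2 x - (1 - x) * Real.logb 2 (1 - x)

/-- `K1(G)`: the set of vertices of degree less than `ε n`. -/
def K1 {n : ℕ} (G : ColoredGraph n) (ε : ℝ) : Set (Fin n) :=
  {x | (G.deg x : ℝ) < ε * n}

/-- `κ1(G) = |K1(G)|`. -/
def kappa1 {n : ℕ} (G : ColoredGraph n) (ε : ℝ) : ℕ := (K1 G ε).ncard

/-- `X1(n,t)`: OBTF graphs with `κ1(G) ≥ t`. -/
def X1set (n t : ℕ) (ε : ℝ) : Set (ColoredGraph n) :=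
  {G ∈ obtfSet n | t ≤ kappa1 G ε}

/-- A collection witnessing `κ2(G) ≥ l`: `2l` distinct vertices
`x_1,…,x_l,y_1,…,y_l ∈ [n] ∖ K1(G)` with `|Γ(x_i) ∩ Γ(y_i)| < ε n` for all `i`. -/
def IsK2Coll {n : ℕ} (G : ColoredGraph n) (ε : ℝ) (l : ℕ)
    (f : Fin l ⊕ Fin l → Fin n) : Prop :=
  Function.Injective f ∧ (∀ v, f v ∉ K1 G ε) ∧
    ∀ i : Fin l, ((G.nbhd (f (Sum.inl i)) ∩ G.nbhd (f (Sum.inr i))).ncard : ℝ) < ε * n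

/-- `κ2(G)`: the largest `l` admitting a collection as above. -/
def kappa2 {n : ℕ} (G : ColoredGraph n) (ε : ℝ) : ℕ :=
  sSup {l | ∃ f : Fin l ⊕ Fin l → Fin n, IsK2Coll G ε l f}

/-- `X2(n,t)`: graphs in `𝓕(n) ∖ (X0(n) ∪ X1(n))` with `κ2(G) ≥ t`,
where `X0(n) = X0(n,s)`, `X1(n) = X1(n,s)`, `s = ⌈C log₂ n⌉`. -/
def X2set (n t : ℕ) (ε C : ℝ) : Set (ColoredGraph n) :=
  {G ∈ obtfSet n \ (X0set n ⌈C * Real.logb 2 n⌉₊ ∪ X1set n ⌈C * Real.logb 2 n⌉₊ ε) |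
    t ≤ kappa2 G ε}

/-- `K` is the vertex set of a maximum collection as in the definition of `κ2(G)`. -/
def IsMaxK2 {n : ℕ} (G : ColoredGraph n) (ε : ℝ) (K : Set (Fin n)) : Prop :=
  ∃ f : Fin (kappa2 G ε) ⊕ Fin (kappa2 G ε) → Fin n,
    IsK2Coll G ε (kappa2 G ε) f ∧ Set.range f = K

theorem greedy_cover {n : ℕ} (A : Fin n → Fin n → Prop) (T Y : Finset (Fin n)) (p : ℝ)
    (hp0 : 0 ≤ p) (hp1 : p ≤ 1)
    (h : ∀ y ∈ Y, p * n ≤ ({v ∈ T | A y v} : Set (Fin n)).ncard) :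
    ∀ k : ℕ, k ≤ T.card → ∃ Q : Finset (Fin n), Q ⊆ T ∧ Q.card = k ∧
      (({y | y ∈ Y ∧ ∀ v ∈ Q, ¬ A y v} : Set (Fin n)).ncard : ℝ) ≤ (1 - p) ^ k * n := by
  classical
  intro k
  induction k with
  | zero =>
    intro _
    refine ⟨∅, by simp, by simp, ?_⟩
    simp only [pow_zero, one_mul]
    have := Set.ncard_le_card (s := ({y | y ∈ Y ∧ ∀ v ∈ (∅ : Finset (Fin n)), ¬ A y v} : Set (Fin n)))
    simp only [Nat.card_eq_fintype_card, Fintype.card_fin] at this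
    exact_mod_cast this
  | succ k ih =>
    intro hk
    obtain ⟨Q, hQT, hQk, hQ⟩ := ih (by omega)
    set U : Finset (Fin n) := Y.filter (fun y => ∀ v ∈ Q, ¬ A y v) with hU
    have hUe : ({y | y ∈ Y ∧ ∀ v ∈ Q, ¬ A y v} : Set (Fin n)) = (U : Set (Fin n)) := by
      ext y; simp [hU]
    rw [hUe, Set.ncard_coe_finset] at hQ
    have hne : (T \ Q).Nonempty := by
      rw [← Finset.card_pos, Finset.card_sdiff_of_subset hQT]; omega
    obtain ⟨v, hv, hvU⟩ : ∃ v ∈ T \ Q, p * U.card ≤ ((U.filter (fun y => A y v)).card : ℝ) := by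
      by_contra hcon
      push Not at hcon
      have h1 : ∑ v ∈ T \ Q, ((U.filter (fun y => A y v)).card : ℝ)
          < ∑ v ∈ T \ Q, p * U.card := Finset.sum_lt_sum_of_nonempty hne hcon
      have h2 : ∑ v ∈ T \ Q, (U.filter (fun y => A y v)).card
          = ∑ y ∈ U, ((T \ Q).filter (fun v => A y v)).card := by
        exact (Finset.sum_card_bipartiteAbove_eq_sum_card_bipartiteBelow (s := U) (t := T \ Q) A).symm
      have h3 : ∑ y ∈ U, (p * n) ≤ ∑ y ∈ U, (((T \ Q).filter (fun v => A y v)).card : ℝ) := by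
        apply Finset.sum_le_sum
        intro y hy
        have hy' := Finset.mem_filter.1 hy
        refine (h y hy'.1).trans ?_
        have : ({v ∈ T | A y v} : Set (Fin n))
            = (((T \ Q).filter (fun v => A y v) : Finset (Fin n)) : Set (Fin n)) := by
          ext v
          simp only [Set.mem_setOf_eq, Finset.coe_filter, Finset.mem_sdiff]
          have := hy'.2 v
          tauto
        rw [this, Set.ncard_coe_finset]
      have h4 : ((T \ Q).card : ℝ) ≤ n := by
        have := Finset.card_le_univ (T \ Q)
        simp only [Fintype.card_fin] at this
        exact_mod_cast this
      have h2' : ∑ v ∈ T \ Q, ((U.filter (fun y => A y v)).card : ℝ)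
          = ∑ y ∈ U, (((T \ Q).filter (fun v => A y v)).card : ℝ) := by exact_mod_cast h2
      rw [h2'] at h1
      simp only [Finset.sum_const, nsmul_eq_mul] at h1 h3
      have h5 : 0 ≤ p * (U.card : ℝ) := by positivity
      nlinarith [mul_le_mul_of_nonneg_right h4 h5]
    have hv' := Finset.mem_sdiff.1 hv
    refine ⟨insert v Q, Finset.insert_subset hv'.1 hQT, ?_, ?_⟩
    · rw [Finset.card_insert_of_notMem hv'.2, hQk]
    · have hE : ({y | y ∈ Y ∧ ∀ w ∈ insert v Q, ¬ A y w} : Set (Fin n))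
          = ((U.filter (fun y => ¬ A y v) : Finset (Fin n)) : Set (Fin n)) := by
        ext y; simp [hU]; tauto
      rw [hE, Set.ncard_coe_finset]
      have hs := Finset.card_filter_add_card_filter_not (s := U) (fun y => A y v)
      have hs' : ((U.filter (fun y => A y v)).card : ℝ) + (U.filter (fun y => ¬ A y v)).card
          = U.card := by exact_mod_cast hs
      have : (1 - p) * U.card ≤ (1 - p) * ((1 - p) ^ k * n) :=
        mul_le_mul_of_nonneg_left hQ (by linarith)
      rw [pow_succ]
      nlinarith

theorem max_common {n : ℕ} (G : ColoredGraph n) (ε : ℝ) (K : Set (Fin n)) (hK : IsMaxK2 G ε K)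
    (x y : Fin n) (hx : x ∉ K1 G ε ∪ K) (hy : y ∉ K1 G ε ∪ K) (hxy : x ≠ y) :
    ε * n ≤ ((G.nbhd x ∩ G.nbhd y).ncard : ℝ) := by
  obtain ⟨f, ⟨hinj, hK1, hc⟩, rfl⟩ := hK
  by_contra hcon
  push Not at hcon
  simp only [Set.mem_union, Set.mem_range, not_or, not_exists] at hx hy
  have hmem : kappa2 G ε + 1 ∈ {l | ∃ f : Fin l ⊕ Fin l → Fin n, IsK2Coll G ε l f} := by
    generalize kappa2 G ε = l at *
    have hl : Function.Injective (fun i => f (Sum.inl i)) := fun a b h => by simpa using hinj h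
    have hr : Function.Injective (fun i => f (Sum.inr i)) := fun a b h => by simpa using hinj h
    have hlr : ∀ a b, f (Sum.inl a) ≠ f (Sum.inr b) := fun a b h => by simpa using hinj h
    refine ⟨Sum.elim (Fin.snoc (α := fun _ => Fin n) (fun i => f (Sum.inl i)) x)
      (Fin.snoc (α := fun _ => Fin n) (fun i => f (Sum.inr i)) y), ?_, ?_, ?_⟩
    · apply Function.Injective.sumElim
      · rw [Fin.snoc_injective_iff]
        exact ⟨hl, by rintro ⟨i, hi⟩; exact hx.2 _ hi⟩
      · rw [Fin.snoc_injective_iff]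
        exact ⟨hr, by rintro ⟨i, hi⟩; exact hy.2 _ hi⟩
      · intro a b
        induction a using Fin.lastCases <;> induction b using Fin.lastCases <;>
          simp only [Fin.snoc_last, Fin.snoc_castSucc]
        · exact hxy
        · exact fun h => hx.2 _ h.symm
        · exact fun h => hy.2 _ h
        · exact hlr _ _
    · rintro (a | a) <;> induction a using Fin.lastCases <;>
        simp only [Sum.elim_inl, Sum.elim_inr, Fin.snoc_last, Fin.snoc_castSucc]
      · exact hx.1
      · exact hK1 _
      · exact hy.1
      · exact hK1 _
    · intro i
      induction i using Fin.lastCases <;>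
        simp only [Sum.elim_inl, Sum.elim_inr, Fin.snoc_last, Fin.snoc_castSucc]
      · exact hcon
      · exact hc _
  have hb : BddAbove {l | ∃ f : Fin l ⊕ Fin l → Fin n, IsK2Coll G ε l f} := by
    refine ⟨n, ?_⟩
    rintro l ⟨g, hg, -⟩
    have := Fintype.card_le_of_injective g hg
    simp at this
    omega
  have h := le_csSup hb hmem
  change kappa2 G ε + 1 ≤ kappa2 G ε at h
  omega

theorem asymp_good (ε : ℝ) (hε0 : 0 < ε) (hε1 : ε < 1 / 2) (C : ℝ) (hC : 0 < C) :
    ∃ N : ℕ, ∀ n : ℕ, N ≤ n → 1 < n ∧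
      Real.log 2 * ε ≤ ε - 6 * (⌈C * Real.logb 2 n⌉₊ : ℝ) / n ∧
      (⌈Real.logb 2 n⌉₊ : ℝ) ≤ Real.log 2 * ε * n ∧
      (⌈Real.logb 2 n⌉₊ : ℝ) + 1 ≤ (n : ℝ) ^ ((1 : ℝ) - ε) := by
  have hlog2 : Real.log 2 < 0.7 := by linarith [Real.log_two_lt_d9]
  have hlog2' : 0.6 < Real.log 2 := by linarith [Real.log_two_gt_d9]
  have hlo : ∀ r : ℝ, 0 < r → ∀ c : ℝ, 0 < c → ∀ᶠ n : ℕ in atTop,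
      Real.log (n : ℝ) ≤ c * (n : ℝ) ^ r := by
    intro r hr c hc
    have h := (isLittleO_log_rpow_atTop hr).bound hc
    have h' := tendsto_natCast_atTop_atTop (R := ℝ) |>.eventually h
    filter_upwards [h'] with n hn
    rw [Real.norm_of_nonneg (by positivity : (0:ℝ) ≤ (n : ℝ) ^ r)] at hn
    exact (le_abs_self _).trans hn
  have hbig : ∀ r : ℝ, 0 < r → ∀ M : ℝ, ∀ᶠ n : ℕ in atTop, M ≤ (n : ℝ) ^ r := by
    intro r hr M
    exact tendsto_natCast_atTop_atTop (R := ℝ) |>.eventually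
      ((tendsto_rpow_atTop hr).eventually_ge_atTop M)
  have key : ∀ r : ℝ, 0 < r → ∀ D : ℝ, 0 < D → ∀ c : ℝ, 0 < c → ∀ᶠ n : ℕ in atTop,
      (⌈D * Real.logb 2 n⌉₊ : ℝ) + 1 ≤ c * (n : ℝ) ^ r := by
    intro r hr D hD c hc
    filter_upwards [hlo r hr (c / 2 * Real.log 2 / D) (by positivity), hbig r hr (4 / c),
      eventually_gt_atTop 1] with n h1 h2 h3
    have h3' : (1 : ℝ) ≤ n := by exact_mod_cast h3.le
    have h0 : 0 ≤ D * Real.logb 2 n :=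
      mul_nonneg hD.le (Real.logb_nonneg (by norm_num) h3')
    have h4 := (Nat.ceil_lt_add_one h0).le
    have h5 : D * Real.logb 2 n ≤ c / 2 * (n : ℝ) ^ r := by
      rw [Real.logb, ← mul_div_assoc, div_le_iff₀ (by linarith)]
      calc D * Real.log n ≤ D * (c / 2 * Real.log 2 / D * (n : ℝ) ^ r) :=
            mul_le_mul_of_nonneg_left h1 hD.le
        _ = _ := by field_simp
    have h6 : 2 ≤ c / 2 * (n : ℝ) ^ r := by
      rw [div_le_iff₀ hc] at h2
      linarith
    linarith
  have hall := (((key 1 one_pos C hC (ε * 0.05) (by positivity)).and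
    (key 1 one_pos 1 one_pos (Real.log 2 * ε) (by positivity))).and
    (key (1 - ε) (by linarith) 1 one_pos 1 one_pos)).and (eventually_gt_atTop 1)
  obtain ⟨N, hN⟩ := eventually_atTop.1 hall
  refine ⟨N, fun n hn => ?_⟩
  obtain ⟨⟨⟨h1, h2⟩, h3⟩, h4⟩ := hN n hn
  simp only [Real.rpow_one, one_mul] at h1 h2 h3
  have hn0 : (0 : ℝ) < n := by exact_mod_cast (by omega : 0 < n)
  refine ⟨h4, ?_, by linarith, h3⟩
  have : 6 * (⌈C * Real.logb 2 n⌉₊ : ℝ) / n ≤ 0.3 * ε := by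
    rw [div_le_iff₀ hn0]
    linarith
  nlinarith

/-- Lemma 3.5: for `G ∈ 𝓕(n) ∖ X0(n)`, any maximum `K2(G)`, any
`x ∉ K1(G) ∪ K2(G)` and any `S` of size at most `6s`, there is
`Q_x ⊆ Γ(x) ∖ S` with `|Q_x| = ⌈log₂ n⌉` and
`|[n] ∖ (K1(G) ∪ K2(G) ∪ Γ(Q_x))| ≤ 2 n^{1-ε}`. -/
theorem exists_good_Qx (ε : ℝ) (hε0 : 0 < ε) (hε1 : ε < 1 / 2) (C : ℝ) (hC : 0 < C) :
    ∃ N : ℕ, ∀ n : ℕ, N ≤ n → ∀ G : ColoredGraph n, G ∈ obtfSet n →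
      G ∉ X0set n ⌈C * Real.logb 2 n⌉₊ →
      ∀ K2 : Set (Fin n), IsMaxK2 G ε K2 →
      ∀ x : Fin n, x ∉ K1 G ε ∪ K2 →
      ∀ S : Set (Fin n), S.ncard ≤ 6 * ⌈C * Real.logb 2 n⌉₊ →
        ∃ Q : Set (Fin n), Q ⊆ G.nbhd x \ S ∧ Q.ncard = ⌈Real.logb 2 n⌉₊ ∧
          ((Set.univ \ (K1 G ε ∪ K2 ∪ G.nbhdSet Q)).ncard : ℝ) ≤
            2 * (n : ℝ) ^ ((1 : ℝ) - ε) := by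
  obtain ⟨N, hN⟩ := asymp_good ε hε0 hε1 C hC
  refine ⟨N, fun n hn G _ _ K2 hK2 x hx S hS => ?_⟩
  obtain ⟨hn1, hp, hq, hq2⟩ := hN n hn
  classical
  have hn0 : (0 : ℝ) < n := by exact_mod_cast (by omega : 0 < n)
  set s := ⌈C * Real.logb 2 n⌉₊
  set q := ⌈Real.logb 2 n⌉₊ with hqdef
  set p : ℝ := ε - 6 * (s : ℝ) / n with hpdef
  have hl2 : 0 < Real.log 2 := Real.log_pos (by norm_num)
  have hp0 : 0 ≤ p := le_trans (by positivity) hp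
  have hp1 : p ≤ 1 := by
    have : 0 ≤ 6 * (s : ℝ) / n := by positivity
    linarith
  have hpn : p * n = ε * n - 6 * s := by rw [hpdef]; field_simp
  have hS' : (S.ncard : ℝ) ≤ 6 * s := by exact_mod_cast hS
  have hdiff : ∀ W : Set (Fin n), ε * n ≤ (W.ncard : ℝ) → p * n ≤ ((W \ S).ncard : ℝ) := by
    intro W hW
    have h1 := Set.ncard_le_ncard_diff_add_ncard W S
    have h2 : (W.ncard : ℝ) ≤ (W \ S).ncard + S.ncard := by exact_mod_cast h1
    linarith
  let T : Finset (Fin n) := (G.nbhd x \ S).toFinset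
  let Y : Finset (Fin n) := ((K1 G ε ∪ K2)ᶜ \ {x}).toFinset
  have hT : p * n ≤ (T.card : ℝ) := by
    have h1 : ¬ ((G.deg x : ℝ) < ε * n) := fun h => hx (Or.inl h)
    have h2 := hdiff (G.nbhd x) (not_lt.1 h1)
    rwa [Set.ncard_eq_toFinset_card'] at h2
  have hqT : q ≤ T.card := by
    have : (q : ℝ) ≤ T.card := by
      have := mul_le_mul_of_nonneg_right hp hn0.le
      linarith
    exact_mod_cast this
  obtain ⟨Q, hQT, hQq, hQ⟩ := greedy_cover (fun y v => G.Adj y v) T Y p hp0 hp1 (by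
    intro y hy
    simp only [Y, Set.mem_toFinset, Set.mem_diff, Set.mem_compl_iff, Set.mem_singleton_iff] at hy
    have h1 := hdiff _ (max_common G ε K2 hK2 x y hx hy.1 (Ne.symm hy.2))
    have h2 : ((G.nbhd x ∩ G.nbhd y) \ S) = ({v ∈ T | G.Adj y v} : Set (Fin n)) := by
      ext v
      have hT' : v ∈ T ↔ G.Adj x v ∧ v ∉ S := by
        simp only [T, Set.mem_toFinset]
        exact Iff.rfl
      change (G.Adj x v ∧ G.Adj y v) ∧ v ∉ S ↔ v ∈ T ∧ G.Adj y v
      tauto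
    rwa [h2] at h1) q hqT
  refine ⟨(Q : Set (Fin n)), ?_, by rw [Set.ncard_coe_finset, hQq], ?_⟩
  · intro v hv
    have := hQT hv
    simpa [T] using this
  · have hsub : (Set.univ \ (K1 G ε ∪ K2 ∪ G.nbhdSet (Q : Set (Fin n)))) ⊆
        ({y | y ∈ Y ∧ ∀ v ∈ Q, ¬ G.Adj y v} ∪ (Q : Set (Fin n))) ∪ {x} := by
      intro y hy
      have hy1 : y ∉ K1 G ε ∪ K2 := fun h => hy.2 (Or.inl h)
      have hy2 : y ∉ G.nbhdSet (Q : Set (Fin n)) := fun h => hy.2 (Or.inr h)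
      by_cases hyx : y = x
      · exact Or.inr hyx
      by_cases hyQ : y ∈ Q
      · exact Or.inl (Or.inr hyQ)
      refine Or.inl (Or.inl ⟨?_, ?_⟩)
      · simp only [Y, Set.mem_toFinset]
        exact ⟨hy1, hyx⟩
      · intro v hv hadj
        apply hy2
        refine ⟨?_, hyQ⟩
        simp only [Set.mem_iUnion]
        exact ⟨v, hv, SimpleGraph.Adj.symm (G := G.graph) hadj⟩
    have hc : ((Set.univ \ (K1 G ε ∪ K2 ∪ G.nbhdSet (Q : Set (Fin n)))).ncard : ℝ) ≤
        (({y | y ∈ Y ∧ ∀ v ∈ Q, ¬ G.Adj y v} : Set (Fin n)).ncard : ℝ) + q + 1 := by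
      have h1 := Set.ncard_le_ncard hsub (Set.toFinite _)
      have h2 := Set.ncard_union_le
        ({y | y ∈ Y ∧ ∀ v ∈ Q, ¬ G.Adj y v} ∪ (Q : Set (Fin n))) {x}
      have h3 := Set.ncard_union_le
        ({y | y ∈ Y ∧ ∀ v ∈ Q, ¬ G.Adj y v}) (Q : Set (Fin n))
      rw [Set.ncard_singleton] at h2
      rw [Set.ncard_coe_finset, hQq] at h3
      exact_mod_cast (by omega)
    have hpow : (1 - p) ^ q * n ≤ (n : ℝ) ^ ((1 : ℝ) - ε) := by
      have e1 : (1 - p) ^ q ≤ Real.exp (-p) ^ q :=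
        pow_le_pow_left₀ (by linarith) (by linarith [Real.add_one_le_exp (-p)]) q
      have hqlog : Real.log n ≤ q * Real.log 2 := by
        have := Nat.le_ceil (Real.logb 2 n)
        rwa [Real.logb, div_le_iff₀ hl2] at this
      have e2 : Real.exp (-p) ^ q ≤ (n : ℝ) ^ (-ε) := by
        rw [← Real.exp_nat_mul, Real.rpow_def_of_pos hn0]
        apply Real.exp_le_exp.2
        have a1 := mul_le_mul_of_nonneg_left hp (Nat.cast_nonneg (α := ℝ) q)
        have a2 := mul_le_mul_of_nonneg_right hqlog hε0.le
        nlinarith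
      have e3 : (n : ℝ) ^ ((1 : ℝ) - ε) = (n : ℝ) ^ (-ε) * n := by
        rw [← Real.rpow_add_one hn0.ne']
        congr 1; ring
      rw [e3]
      exact mul_le_mul_of_nonneg_right (e1.trans e2) hn0.le
    linarith
end
end

section
/- There exist constants δ > 0 and C > 0 such that for all sufficiently large n and every integer t with 1 ≤ t ≤ ⌈C·log n⌉: |{G ∈ 𝓕(n) : κ(G) ≥ t}| < 2^{−δ·n·t}·b(n). -/
open Filter

noncomputable section

namespace OB
open Finset
open scoped Classical

variable {V : Type*} [Fintype V]

/-- Sign matrices of odd-blue-triangle-free colored graphs. -/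
def OK (c : V → V → SignType) : Prop :=
  (∀ x y, c x y = c y x) ∧ (∀ x, c x x = 0) ∧ ∀ x y z, c x y * c y z * c x z ≠ -1

/-- Neighbourhood. -/
def nb (c : V → V → SignType) (x : V) : Finset V := univ.filter fun y => c x y ≠ 0

/-- Vertices not covered by `T`, for a row `f`. -/
def unc (f : V → SignType) (c : V → V → SignType) (T : Finset V) : Finset V :=
  univ.filter fun z => ∀ y ∈ T, f y * c y z = 0

/-- Vertices for which `T` gives conflicting predictions. -/
def cnf (f : V → SignType) (c : V → V → SignType) (T : Finset V) : Finset V :=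
  univ.filter fun z => (∃ y ∈ T, f y * c y z = 1) ∧ ∃ y ∈ T, f y * c y z = -1

/-- `T` witnesses that there are few options for `f`. -/
def IsBadT (k : ℕ) (e : ℝ) (f : V → SignType) (c : V → V → SignType) (R T : Finset V) : Prop :=
  T.card ≤ k ∧ 6 * ((unc f c T \ R).card : ℝ) + e * Fintype.card V
      ≤ 9 * (R.card : ℝ) + 10 * ((cnf f c T \ R).card : ℝ)

/-- Bad vertices. -/
def IsBad (k : ℕ) (e : ℝ) (c : V → V → SignType) (R : Finset V) (x : V) : Prop :=
  128 * (nb c x ∩ R).card ≤ R.card ∧ ∃ T, IsBadT k e (c x) c R T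

/-- The set of bad vertices. -/
def badSet (k : ℕ) (e : ℝ) (c : V → V → SignType) (R : Finset V) : Finset V :=
  univ.filter (IsBad k e c R)

lemma unc_mono (f : V → SignType) (c : V → V → SignType) {T T' : Finset V} (h : T ⊆ T') :
    unc f c T' ⊆ unc f c T := by
  intro z hz
  simp only [unc, mem_filter, mem_univ, true_and] at hz ⊢
  exact fun y hy => hz y (h hy)

lemma greedy (c : V → V → SignType) (x : V) (j : ℕ) :
    ∃ T : Finset V, T.card ≤ j ∧
      (((unc (c x) c T).card : ℝ) ≤ (127/128 : ℝ)^j * Fintype.card V ∨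
        ∀ y ∈ nb c x, 128 * (nb c y ∩ unc (c x) c T).card ≤ (unc (c x) c T).card) := by
  induction j with
  | zero => exact ⟨∅, by simp, Or.inl (by simpa using card_le_univ _)⟩
  | succ j ih =>
    obtain ⟨T, hT, h⟩ := ih
    by_cases hs : ∀ y ∈ nb c x, 128 * (nb c y ∩ unc (c x) c T).card ≤ (unc (c x) c T).card
    · exact ⟨T, by omega, Or.inr hs⟩
    · have h1 := h.resolve_right hs
      push Not at hs
      obtain ⟨y, hy, hlt⟩ := hs
      refine ⟨insert y T, (card_insert_le _ _).trans (by omega), Or.inl ?_⟩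
      have hsub : unc (c x) c (insert y T) ⊆ unc (c x) c T \ nb c y := by
        intro z hz
        rw [Finset.mem_sdiff]
        simp only [unc, nb, mem_filter, mem_univ, true_and, mem_insert,
          forall_eq_or_imp, not_not] at hz hy ⊢
        exact ⟨hz.2, (mul_eq_zero.1 hz.1).resolve_left hy⟩
      have h2 := card_le_card hsub
      have h3 := card_sdiff_add_card_inter (unc (c x) c T) (nb c y)
      rw [inter_comm] at h3
      have h4 : 128 * ((unc (c x) c (insert y T)).card) ≤ 127 * (unc (c x) c T).card := by omega
      have h5 : 128 * ((unc (c x) c (insert y T)).card : ℝ) ≤ 127 * (unc (c x) c T).card := by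
        exact_mod_cast h4
      rw [pow_succ]
      linarith

lemma bad_univ_deg (k : ℕ) (e : ℝ) (he : e ≤ 9) (c : V → V → SignType) (x : V)
    (hx : x ∉ badSet k e c univ) : (Fintype.card V : ℝ) < 128 * (nb c x).card := by
  by_contra h
  apply hx
  simp only [badSet, mem_filter, mem_univ, true_and]
  refine ⟨?_, ∅, by simp, ?_⟩
  · push Not at h
    rw [inter_univ, card_univ]
    exact_mod_cast h
  · simp only [subset_univ, sdiff_eq_empty_iff_subset.2, card_empty, card_univ]
    have : (0:ℝ) ≤ Fintype.card V := by positivity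
    push_cast
    nlinarith

/-- The constant `ε`. -/
def ep : ℝ := 1 / 2^41

section det
variable (c : V → V → SignType) (hc : OK c) (k : ℕ) (hk : (127/128 : ℝ)^k < ep)
  (hV : 0 < Fintype.card V)
  (hmu : ∀ R, ((badSet (k+1) ep c R).card : ℝ) ≤ 1/2^20 * Fintype.card V)

include hk hV hmu in
lemma cover : ∀ x ∉ badSet (k+1) ep c univ, ∃ T : Finset V, T.card ≤ k ∧
    ((unc (c x) c T).card : ℝ) < ep * Fintype.card V := by
  have hn : (0:ℝ) < Fintype.card V := by exact_mod_cast hV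
  choose T hT h using fun x => greedy c x k
  by_contra hcon
  push Not at hcon
  obtain ⟨x0, hx0, hx0'⟩ := hcon
  obtain ⟨x, hx, hmax⟩ := exists_max_image ((badSet (k+1) ep c univ)ᶜ)
    (fun x => (unc (c x) c (T x)).card) ⟨x0, by simpa using hx0⟩
  have hxb : x ∉ badSet (k+1) ep c univ := by simpa using hx
  have hbig : ep * Fintype.card V ≤ ((unc (c x) c (T x)).card : ℝ) := by
    refine (hx0' (T x0) (hT x0)).trans ?_
    exact_mod_cast hmax x0 (by simpa using hx0)
  have hst : ∀ y ∈ nb c x, 128 * (nb c y ∩ unc (c x) c (T x)).card ≤ (unc (c x) c (T x)).card := by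
    refine (h x).resolve_left fun h1 => ?_
    have := mul_lt_mul_of_pos_right hk hn
    linarith
  have hsub : nb c x ⊆ badSet (k+1) ep c univ ∪ badSet (k+1) ep c (unc (c x) c (T x)) := by
    intro y hy
    rw [mem_union]
    by_cases hyb : y ∈ badSet (k+1) ep c univ
    · exact Or.inl hyb
    · right
      simp only [badSet, mem_filter, mem_univ, true_and]
      refine ⟨hst y hy, T y, (hT y).trans (by omega), ?_⟩
      have h1 : ((unc (c y) c (T y) \ unc (c x) c (T x)).card : ℝ) ≤ (unc (c x) c (T x)).card := by
        exact_mod_cast (card_le_card sdiff_subset).trans (hmax y (by simpa using hyb))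
      have h2 : (0:ℝ) ≤ ((cnf (c y) c (T y) \ unc (c x) c (T x)).card : ℝ) := by positivity
      linarith
  have h1 := (card_le_card hsub).trans (card_union_le _ _)
  have h2 : ((nb c x).card : ℝ) ≤ (badSet (k+1) ep c univ).card
      + (badSet (k+1) ep c (unc (c x) c (T x))).card := by exact_mod_cast h1
  have h3 := bad_univ_deg (k+1) ep (by norm_num [ep]) c x hxb
  have h4 := hmu univ
  have h5 := hmu (unc (c x) c (T x))
  linarith

/-- Sign predicted by `T`. -/
def sg (T : V → Finset V) (v z : V) : SignType :=
  if ∃ y ∈ T v, c v y * c y z = 1 then 1 else -1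

variable (T : V → Finset V) (hT : ∀ x ∉ badSet (k+1) ep c univ, (T x).card ≤ k ∧
    ((unc (c x) c (T x)).card : ℝ) < ep * Fintype.card V)

lemma st (a : SignType) : a = 0 ∨ a = 1 ∨ a = -1 := by revert a; decide

include hT in
lemma err_bound (v : V) (hv : v ∉ badSet (k+1) ep c univ) (hv' : v ∉ badSet (k+1) ep c ∅)
    (y : V) : ((univ.filter fun z => c v y * c y z ≠ 0 ∧ c v y * c y z ≠ sg c T v z).card : ℝ)
      ≤ 2 * ep * Fintype.card V := by
  have hsub : (univ.filter fun z => c v y * c y z ≠ 0 ∧ c v y * c y z ≠ sg c T v z) ⊆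
      unc (c v) c (T v) ∪ cnf (c v) c (insert y (T v)) := by
    intro z hz
    simp only [mem_filter, mem_univ, true_and] at hz
    rw [mem_union]
    by_cases hu : z ∈ unc (c v) c (T v)
    · exact Or.inl hu
    · right
      simp only [unc, mem_filter, mem_univ, true_and] at hu
      push Not at hu
      obtain ⟨y0, hy0, hp⟩ := hu
      simp only [cnf, mem_filter, mem_univ, true_and]
      unfold sg at hz
      split_ifs at hz with hs
      · obtain ⟨y1, hy1, hp1⟩ := hs
        refine ⟨⟨y1, mem_insert_of_mem hy1, hp1⟩, y, mem_insert_self _ _, ?_⟩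
        rcases st (c v y * c y z) with h | h | h
        · exact absurd h hz.1
        · exact absurd h hz.2
        · exact h
      · refine ⟨⟨y, mem_insert_self _ _, ?_⟩, y0, mem_insert_of_mem hy0, ?_⟩
        · rcases st (c v y * c y z) with h | h | h
          · exact absurd h hz.1
          · exact h
          · exact absurd h hz.2
        · rcases st (c v y0 * c y0 z) with h | h | h
          · exact absurd h hp
          · exact absurd ⟨y0, hy0, h⟩ hs
          · exact h
  have h1 := (card_le_card hsub).trans (card_union_le _ _)
  have h1' : ((univ.filter fun z => c v y * c y z ≠ 0 ∧ c v y * c y z ≠ sg c T v z).card : ℝ) ≤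
    (unc (c v) c (T v)).card + (cnf (c v) c (insert y (T v))).card := by exact_mod_cast h1
  obtain ⟨hT1, hT2⟩ := hT v hv
  have h3 : ¬ (6 * ((unc (c v) c (insert y (T v))).card : ℝ) + ep * Fintype.card V
      ≤ 10 * ((cnf (c v) c (insert y (T v))).card : ℝ)) := by
    intro h
    apply hv'
    simp only [badSet, mem_filter, mem_univ, true_and]
    refine ⟨by simp, insert y (T v), (card_insert_le _ _).trans (by omega), ?_⟩
    simpa using h
  have h4 : ((unc (c v) c (insert y (T v))).card : ℝ) ≤ (unc (c v) c (T v)).card := by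
    exact_mod_cast card_le_card (unc_mono _ _ (subset_insert _ _))
  linarith

/-- Exceptional vertices. -/
def exc (v : V) : Finset V := univ.filter fun a => (1/2^22 : ℝ) * Fintype.card V ≤
  ((univ.filter fun y => c v y * c y a ≠ 0 ∧ c v y * c y a ≠ sg c T v a).card : ℝ)

include hT hV in
lemma exc_bound (v : V) (hv : v ∉ badSet (k+1) ep c univ) (hv' : v ∉ badSet (k+1) ep c ∅) :
    ((exc c T v).card : ℝ) ≤ 1/2^18 * Fintype.card V := by
  have hn : (0:ℝ) < Fintype.card V := by exact_mod_cast hV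
  have h1 : ∑ a ∈ exc c T v, (1/2^22 : ℝ) * Fintype.card V ≤
      ∑ a, ((univ.filter fun y => c v y * c y a ≠ 0 ∧ c v y * c y a ≠ sg c T v a).card : ℝ) := by
    refine (sum_le_sum (g := fun a => ((univ.filter fun y => c v y * c y a ≠ 0 ∧ c v y * c y a ≠ sg c T v a).card : ℝ)) ?_).trans
      (sum_le_univ_sum_of_nonneg fun _ => by positivity)
    intro a ha
    exact (mem_filter.1 ha).2
  have h2 : ∑ a, ((univ.filter fun y => c v y * c y a ≠ 0 ∧ c v y * c y a ≠ sg c T v a).card : ℝ)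
      = ∑ y, ((univ.filter fun a => c v y * c y a ≠ 0 ∧ c v y * c y a ≠ sg c T v a).card : ℝ) := by
    simp only [card_filter]
    push_cast
    rw [sum_comm]
  have h3 : ∑ y, ((univ.filter fun a => c v y * c y a ≠ 0 ∧ c v y * c y a ≠ sg c T v a).card : ℝ)
      ≤ ∑ _y : V, 2 * ep * Fintype.card V := sum_le_sum fun y _ => err_bound c k T hT v hv hv' y
  rw [sum_const, nsmul_eq_mul] at h1 h3
  rw [card_univ] at h3
  have h4 := h1.trans (h2.le.trans h3)
  have h5 : (exc c T v).card * (1/2^22 : ℝ) * Fintype.card V ≤ (2 * ep * Fintype.card V) * Fintype.card V := by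
    linarith
  have h6 := le_of_mul_le_mul_right h5 hn
  unfold ep at h6
  linarith

include hT in
lemma rich (R : Finset V) (hR : ep * Fintype.card V ≤ (R.card : ℝ)) (z : V)
    (hz : z ∉ badSet (k+1) ep c univ) (hz' : z ∉ badSet (k+1) ep c R) :
    (R.card : ℝ) < 128 * (nb c z ∩ R).card := by
  by_contra h
  apply hz'
  simp only [badSet, mem_filter, mem_univ, true_and]
  obtain ⟨hT1, hT2⟩ := hT z hz
  refine ⟨by push Not at h; exact_mod_cast h, T z, by omega, ?_⟩
  have h1 : ((unc (c z) c (T z) \ R).card : ℝ) ≤ (unc (c z) c (T z)).card := by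
    exact_mod_cast card_le_card sdiff_subset
  have h2 : (0:ℝ) ≤ ((cnf (c z) c (T z) \ R).card : ℝ) := by positivity
  linarith

include hc hT hV in
lemma edge_sign (v : V) (hv : v ∉ badSet (k+1) ep c univ)
    (a : V) (ha : a ∉ exc c T v) (ha1 : a ∉ badSet (k+1) ep c univ)
    (ha2 : a ∉ badSet (k+1) ep c (nb c v))
    (b : V) (hb : b ∉ exc c T v) (hb1 : b ∉ badSet (k+1) ep c univ)
    (hb2 : b ∉ badSet (k+1) ep c (nb c a ∩ nb c v)) (hab : c a b ≠ 0) :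
    c a b = sg c T v a * sg c T v b := by
  have hn : (0:ℝ) < Fintype.card V := by exact_mod_cast hV
  have h1 := bad_univ_deg (k+1) ep (by norm_num [ep]) c v hv
  have h2 := rich c k T hT (nb c v) (by unfold ep; linarith) a ha1 ha2
  have h3 := rich c k T hT (nb c a ∩ nb c v) (by unfold ep; linarith) b hb1 hb2
  simp only [exc, mem_filter, mem_univ, true_and, not_le] at ha hb
  have hex : ∃ y ∈ nb c b ∩ (nb c a ∩ nb c v),
      y ∉ (univ.filter fun y => c v y * c y a ≠ 0 ∧ c v y * c y a ≠ sg c T v a) ∪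
        (univ.filter fun y => c v y * c y b ≠ 0 ∧ c v y * c y b ≠ sg c T v b) := by
    by_contra hcon
    push Not at hcon
    have h4 := (card_le_card hcon).trans (card_union_le _ _)
    have h5 : ((nb c b ∩ (nb c a ∩ nb c v)).card : ℝ) ≤
      (univ.filter fun y => c v y * c y a ≠ 0 ∧ c v y * c y a ≠ sg c T v a).card +
        (univ.filter fun y => c v y * c y b ≠ 0 ∧ c v y * c y b ≠ sg c T v b).card := by
      exact_mod_cast h4
    linarith
  obtain ⟨y, hy, hy'⟩ := hex
  simp only [mem_inter, mem_union, nb, mem_filter, mem_univ, true_and, not_or] at hy hy'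
  obtain ⟨hyb, hya, hyv⟩ := hy
  rw [hc.1] at hyb hya
  have e1 : c v y * c y a = sg c T v a := by
    by_contra h; exact hy'.1 ⟨mul_ne_zero hyv hya, h⟩
  have e2 : c v y * c y b = sg c T v b := by
    by_contra h; exact hy'.2 ⟨mul_ne_zero hyv hyb, h⟩
  rw [← e1, ← e2]
  have htri := hc.2.2 y a b
  revert htri hyb hya hyv hab
  generalize c v y = p
  generalize c y a = q
  generalize c y b = r
  generalize c a b = s
  revert p q r s
  decide

/-- Where the predictions agree. -/
def agr (v v' : V) (s : SignType) : Finset V :=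
  univ.filter fun z => sg c T v z = s * sg c T v' z

include hc hT hV hmu in
lemma rigid (v : V) (hv : v ∉ badSet (k+1) ep c univ) (hv0 : v ∉ badSet (k+1) ep c ∅)
    (v' : V) (hv' : v' ∉ badSet (k+1) ep c univ) (hv0' : v' ∉ badSet (k+1) ep c ∅)
    (h1 : 1/256 * (Fintype.card V : ℝ) ≤ (agr c T v v' 1).card)
    (h2 : 1/256 * (Fintype.card V : ℝ) ≤ (agr c T v v' (-1)).card) : False := by
  have hn : (0:ℝ) < Fintype.card V := by exact_mod_cast hV
  have e1 := exc_bound c k hV T hT v hv hv0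
  have e2 := exc_bound c k hV T hT v' hv' hv0'
  set B := agr c T v v' (-1) with hB
  have hexa : ∃ a ∈ agr c T v v' 1, a ∉ exc c T v ∪ (exc c T v' ∪ (badSet (k+1) ep c univ ∪
      (badSet (k+1) ep c (nb c v) ∪ (badSet (k+1) ep c (nb c v') ∪ badSet (k+1) ep c B)))) := by
    by_contra hcon
    push Not at hcon
    have h4 := (card_le_card hcon).trans ((card_union_le _ _).trans (add_le_add_right
      ((card_union_le _ _).trans (add_le_add_right ((card_union_le _ _).trans (add_le_add_right
      ((card_union_le _ _).trans (add_le_add_right (card_union_le _ _) _)) _)) _)) _))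
    have h5 : ((agr c T v v' 1).card : ℝ) ≤ (exc c T v).card + ((exc c T v').card +
      ((badSet (k+1) ep c univ).card + ((badSet (k+1) ep c (nb c v)).card +
      ((badSet (k+1) ep c (nb c v')).card + (badSet (k+1) ep c B).card)))) := by exact_mod_cast h4
    have := hmu univ
    have := hmu (nb c v)
    have := hmu (nb c v')
    have := hmu B
    linarith
  obtain ⟨a, haA, ha⟩ := hexa
  simp only [mem_union, not_or] at ha
  obtain ⟨ha1, ha2, ha3, ha4, ha5, ha6⟩ := ha
  have hr := rich c k T hT B (by unfold ep; linarith) a ha3 ha6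
  have hexb : ∃ b ∈ nb c a ∩ B, b ∉ exc c T v ∪ (exc c T v' ∪ (badSet (k+1) ep c univ ∪
      (badSet (k+1) ep c (nb c a ∩ nb c v) ∪ badSet (k+1) ep c (nb c a ∩ nb c v')))) := by
    by_contra hcon
    push Not at hcon
    have h4 := (card_le_card hcon).trans ((card_union_le _ _).trans (add_le_add_right
      ((card_union_le _ _).trans (add_le_add_right ((card_union_le _ _).trans (add_le_add_right
      (card_union_le _ _) _)) _)) _))
    have h5 : ((nb c a ∩ B).card : ℝ) ≤ (exc c T v).card + ((exc c T v').card +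
      ((badSet (k+1) ep c univ).card + ((badSet (k+1) ep c (nb c a ∩ nb c v)).card +
      (badSet (k+1) ep c (nb c a ∩ nb c v')).card))) := by exact_mod_cast h4
    have := hmu univ
    have := hmu (nb c a ∩ nb c v)
    have := hmu (nb c a ∩ nb c v')
    linarith
  obtain ⟨b, hbB, hb⟩ := hexb
  simp only [mem_union, not_or] at hb
  obtain ⟨hb1, hb2, hb3, hb4, hb5⟩ := hb
  rw [mem_inter] at hbB
  have hab : c a b ≠ 0 := by simpa [nb] using hbB.1
  have s1 := edge_sign c hc k hV T hT v hv a ha1 ha3 ha4 b hb1 hb3 hb4 hab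
  have s2 := edge_sign c hc k hV T hT v' hv' a ha2 ha3 ha5 b hb2 hb3 hb5 hab
  have t1 : sg c T v a = 1 * sg c T v' a := by simpa [agr] using haA
  have t2 : sg c T v b = -1 * sg c T v' b := by simpa [hB, agr] using hbB.2
  rw [s1, t1, t2] at s2
  rw [s1, t1, t2] at hab
  revert s2 hab
  generalize sg c T v' a = p
  generalize sg c T v' b = q
  revert p q
  decide

include hc hT hV in
lemma adj_agr (v : V) (hv : v ∉ badSet (k+1) ep c univ) (hv0 : v ∉ badSet (k+1) ep c ∅)
    (v' : V) (hv' : v' ∉ badSet (k+1) ep c univ) (hvv : c v v' ≠ 0) :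
    1/256 * (Fintype.card V : ℝ) ≤ (agr c T v v' (c v v')).card := by
  have hn : (0:ℝ) < Fintype.card V := by exact_mod_cast hV
  have hsub : nb c v' ⊆ agr c T v v' (c v v') ∪ ((univ.filter fun z => c v v' * c v' z ≠ 0 ∧
      c v v' * c v' z ≠ sg c T v z) ∪ unc (c v') c (T v')) := by
    intro z hz
    have hz' : c v' z ≠ 0 := by simpa [nb] using hz
    simp only [mem_union]
    by_cases h1 : z ∈ unc (c v') c (T v')
    · tauto
    by_cases h2 : c v v' * c v' z = sg c T v z
    · left
      simp only [agr, mem_filter, mem_univ, true_and]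
      rw [← h2]
      congr 1
      simp only [unc, mem_filter, mem_univ, true_and] at h1
      push Not at h1
      obtain ⟨y0, hy0, hp⟩ := h1
      have key : ∀ y, c v' y * c y z ≠ 0 → c v' y * c y z = c v' z := by
        intro y h
        have := hc.2.2 v' y z
        revert h this hz'
        generalize c v' y = p
        generalize c y z = q
        generalize c v' z = r
        revert p q r
        decide
      unfold sg
      split_ifs with hs
      · obtain ⟨y, _, hy⟩ := hs
        rw [← key y (by rw [hy]; decide), hy]
      · rw [← key y0 hp]
        rcases st (c v' y0 * c y0 z) with h | h | h
        · exact absurd h hp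
        · exact absurd ⟨y0, hy0, h⟩ hs
        · exact h
    · right; left
      simp only [mem_filter, mem_univ, true_and]
      exact ⟨mul_ne_zero hvv hz', h2⟩
  have h4 := (card_le_card hsub).trans ((card_union_le _ _).trans (add_le_add_right
      (card_union_le _ _) _))
  have h5 : ((nb c v').card : ℝ) ≤ (agr c T v v' (c v v')).card +
     ((univ.filter fun z => c v v' * c v' z ≠ 0 ∧
      c v v' * c v' z ≠ sg c T v z).card + (unc (c v') c (T v')).card) := by exact_mod_cast h4
  have h6 := err_bound c k T hT v hv hv0 v'
  have h7 := (hT v' hv').2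
  have h8 := bad_univ_deg (k+1) ep (by norm_num [ep]) c v' hv'
  unfold ep at h6 h7
  linarith

lemma agr_compl (v v' : V) : (agr c T v v' 1).card + (agr c T v v' (-1)).card
    = Fintype.card V := by
  rw [← card_univ, ← card_union_of_disjoint]
  · congr 1
    ext z
    simp only [agr, mem_union, mem_filter, mem_univ, true_and, iff_true]
    unfold sg
    split_ifs <;> decide
  · rw [disjoint_left]
    intro z
    simp only [agr, mem_filter, mem_univ, true_and]
    unfold sg
    split_ifs <;> decide

end det

/-- Balanced outside of `D`. -/
def BalOff (c : V → V → SignType) (D : Finset V) : Prop :=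
  ∃ g : V → SignType, (∀ v, g v ≠ 0) ∧ ∀ v ∉ D, ∀ v' ∉ D, c v v' ≠ 0 → c v v' = g v * g v'

theorem det_main (c : V → V → SignType) (hc : OK c) (k : ℕ) (hk : (127/128 : ℝ)^k < ep)
    (hmu : ∀ R, ((badSet (k+1) ep c R).card : ℝ) ≤ 1/2^20 * Fintype.card V) :
    BalOff c (badSet (k+1) ep c ∅ ∪ badSet (k+1) ep c univ) := by
  by_cases hne : ∃ v0, v0 ∉ badSet (k+1) ep c ∅ ∪ badSet (k+1) ep c univ
  swap
  · push Not at hne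
    exact ⟨fun _ => 1, fun _ => by dsimp only; decide, fun v hv => absurd (hne v) hv⟩
  obtain ⟨v0, hv0⟩ := hne
  have hV : 0 < Fintype.card V := Fintype.card_pos_iff.2 ⟨v0⟩
  have hn : (0:ℝ) < Fintype.card V := by exact_mod_cast hV
  have hcov := cover c k hk hV hmu
  have : ∀ x, ∃ T : Finset V, x ∉ badSet (k+1) ep c univ → T.card ≤ k ∧
    ((unc (c x) c T).card : ℝ) < ep * Fintype.card V := by
    intro x
    by_cases hx : x ∈ badSet (k+1) ep c univ
    · exact ⟨∅, fun h => absurd hx h⟩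
    · obtain ⟨T, h⟩ := hcov x hx
      exact ⟨T, fun _ => h⟩
  choose T hT using this
  -- main dichotomy
  have hdich : ∀ s : SignType, s ≠ 0 → ∀ v ∉ badSet (k+1) ep c ∅ ∪ badSet (k+1) ep c univ,
      ∀ v' ∉ badSet (k+1) ep c ∅ ∪ badSet (k+1) ep c univ,
      1/256 * (Fintype.card V : ℝ) ≤ (agr c T v v' s).card →
      (1 - 1/256) * (Fintype.card V : ℝ) < (agr c T v v' s).card := by
    intro s hs v hv v' hv' hlarge
    simp only [mem_union, not_or] at hv hv'
    have hr := rigid c hc k hV hmu T hT v hv.2 hv.1 v' hv'.2 hv'.1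
    have hcm : ((agr c T v v' 1).card : ℝ) + (agr c T v v' (-1)).card
      = Fintype.card V := by exact_mod_cast agr_compl c T v v'
    rcases st s with h | h | h
    · exact absurd h hs
    · subst h
      by_contra hcon
      exact hr hlarge (by linarith)
    · subst h
      by_contra hcon
      exact hr (by linarith) hlarge
  refine ⟨fun v => if 1/256 * (Fintype.card V : ℝ) ≤ (agr c T v v0 1).card then 1 else -1,
    fun v => by dsimp only; split_ifs <;> decide, ?_⟩
  have hg : ∀ v ∉ badSet (k+1) ep c ∅ ∪ badSet (k+1) ep c univ,
      (1 - 1/256) * (Fintype.card V : ℝ) < (agr c T v v0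
        (if 1/256 * (Fintype.card V : ℝ) ≤ (agr c T v v0 1).card then 1 else -1)).card := by
    intro v hv
    apply hdich _ (by split_ifs <;> decide) v hv v0 hv0
    have hcm : ((agr c T v v0 1).card : ℝ) + (agr c T v v0 (-1)).card
      = Fintype.card V := by exact_mod_cast agr_compl c T v v0
    split_ifs with h
    · exact h
    · linarith
  intro v hv v' hv' hvv
  dsimp only
  have h1 := hg v hv
  have h2 := hg v' hv'
  set p : SignType := (if 1/256 * (Fintype.card V : ℝ) ≤ (agr c T v v0 1).card then 1 else -1) with hp
  set q : SignType := (if 1/256 * (Fintype.card V : ℝ) ≤ (agr c T v' v0 1).card then 1 else -1) with hq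
  have hp0 : p ≠ 0 := by rw [hp]; split_ifs <;> decide
  have hq0 : q ≠ 0 := by rw [hq]; split_ifs <;> decide
  have h3 : (1 - 1/256) * (Fintype.card V : ℝ) < (agr c T v v' (c v v')).card := by
    apply hdich _ hvv v hv v' hv'
    have a1 := hv
    have a2 := hv'
    simp only [mem_union, not_or] at a1 a2
    exact adj_agr c hc k hV T hT v a1.2 a1.1 v' a2.2 hvv
  have hex : ∃ z, z ∈ agr c T v v0 p ∧ z ∈ agr c T v' v0 q ∧ z ∈ agr c T v v' (c v v') := by
    by_contra hcon
    push Not at hcon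
    have hsub : agr c T v v0 p ⊆ (agr c T v' v0 q)ᶜ ∪ (agr c T v v' (c v v'))ᶜ := by
      intro z hz
      simp only [mem_union, mem_compl]
      have := hcon z hz
      tauto
    have h4 := (card_le_card hsub).trans (card_union_le _ _)
    have h5 : ((agr c T v v0 p).card : ℝ) ≤ ((agr c T v' v0 q)ᶜ).card + ((agr c T v v' (c v v'))ᶜ).card := by
      exact_mod_cast h4
    have c1 : ((agr c T v' v0 q).card : ℝ) + ((agr c T v' v0 q)ᶜ).card = Fintype.card V := by
      exact_mod_cast card_add_card_compl _
    have c2 : ((agr c T v v' (c v v')).card : ℝ) + ((agr c T v v' (c v v'))ᶜ).card = Fintype.card V := by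
      exact_mod_cast card_add_card_compl _
    linarith
  obtain ⟨z, z1, z2, z3⟩ := hex
  simp only [agr, mem_filter, mem_univ, true_and] at z1 z2 z3
  have z0 : sg c T v0 z ≠ 0 := by unfold sg; split_ifs <;> decide
  rw [z1, z2] at z3
  revert z3 z0 hp0 hq0 hvv
  generalize c v v' = s
  generalize sg c T v0 z = r
  generalize p = p
  generalize q = q
  revert s r p q
  decide
lemma st' (a : SignType) : a = 0 ∨ a = 1 ∨ a = -1 := by revert a; decide

lemma univ_sign : (univ : Finset SignType) = {0, 1, -1} := by decide

lemma sum_sign (f : SignType → ℝ) : ∑ a, f a = f 0 + f 1 + f (-1) := by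
  rw [univ_sign, sum_insert (by decide), sum_insert (by decide), sum_singleton]
  ring

lemma rpow_a : (1 + 1/64 : ℝ) ≤ 2 ^ (1/32 : ℝ) := by
  refine le_of_pow_le_pow_left₀ (n := 32) (by norm_num) (by positivity) ?_
  rw [← Real.rpow_natCast (2 ^ (1/32 : ℝ)), ← Real.rpow_mul (by norm_num)]
  norm_num

lemma rpow_b : (3 : ℝ) ≤ 2 ^ (8/5 : ℝ) := by
  refine le_of_pow_le_pow_left₀ (n := 5) (by norm_num) (by positivity) ?_
  rw [← Real.rpow_natCast (2 ^ (8/5 : ℝ)), ← Real.rpow_mul (by norm_num)]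
  norm_num

/-- Rows compatible with the data. -/
def rows (c : V → V → SignType) (R T : Finset V) (f : V → SignType) : Finset (V → SignType) :=
  univ.filter fun g => 128 * ((univ.filter fun z => g z ≠ 0) ∩ R).card ≤ R.card ∧
    ∀ z, ∀ y ∈ T, f y * c y z * g z ≠ -1

lemma rows_card (c : V → V → SignType) (R T : Finset V) (f : V → SignType) :
    ((rows c R T f).card : ℝ) ≤ 2 ^ ((Fintype.card V : ℝ) - 9/10 * R.card
      + 3/5 * (unc f c T \ R).card - (cnf f c T \ R).card) := by
  let g : V → SignType → ℝ := fun z a => if z ∈ R then (if a = 0 then 1 else 1/128) else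
    if ∀ y ∈ T, f y * c y z * a ≠ -1 then 1 else 0
  let e : V → ℝ := fun z => 1 - (if z ∈ R then 31/32 else 0)
    + (if z ∈ unc f c T \ R then 3/5 else 0) - (if z ∈ cnf f c T \ R then 1 else 0)
  have g0 : ∀ z a, 0 ≤ g z a := by
    intro z a; simp only [g]; split_ifs <;> norm_num
  have H1 : ∀ z, ∑ a, g z a ≤ 2 ^ (e z) := by
    intro z
    rw [sum_sign]
    by_cases hR : z ∈ R
    · simp only [g, e, hR, if_true, Finset.mem_sdiff, not_true, and_false, if_false]
      rw [if_neg (by decide), if_neg (by decide)]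
      have := rpow_a
      norm_num at this ⊢
      linarith
    · simp only [g, e, hR, if_false, Finset.mem_sdiff, not_false_eq_true, and_true]
      have b1 : ∀ a : SignType, (if ∀ y ∈ T, f y * c y z * a ≠ -1 then (1:ℝ) else 0) ≤ 1 := by
        intro a; split_ifs <;> norm_num
      by_cases hU : z ∈ unc f c T
      · have hC : z ∉ cnf f c T := by
          simp only [unc, cnf, mem_filter, mem_univ, true_and] at hU ⊢
          rintro ⟨⟨y, hy, h⟩, _⟩
          rw [hU y hy] at h
          exact absurd h (by decide)
        rw [if_pos hU, if_neg hC]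
        have := rpow_b
        have h0 := b1 0
        have h1 := b1 1
        have h2 := b1 (-1)
        norm_num at this h0 h1 h2 ⊢
        linarith
      · by_cases hC : z ∈ cnf f c T
        · rw [if_neg hU, if_pos hC]
          simp only [cnf, mem_filter, mem_univ, true_and] at hC
          obtain ⟨⟨y, hy, h⟩, y', hy', h'⟩ := hC
          have n1 : ¬ ∀ y ∈ T, f y * c y z * 1 ≠ -1 := fun hh => hh y' hy' (by rw [h']; decide)
          have n2 : ¬ ∀ y ∈ T, f y * c y z * (-1) ≠ -1 := fun hh => hh y hy (by rw [h]; decide)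
          have h0 := b1 0
          have e1 : (2:ℝ) ^ ((1:ℝ) - 0 + 0 - 1) = 1 := by norm_num
          rw [if_neg n1, if_neg n2, e1]
          linarith
        · rw [if_neg hU, if_neg hC]
          simp only [unc, mem_filter, mem_univ, true_and] at hU
          push Not at hU
          obtain ⟨y, hy, h⟩ := hU
          have h0 := b1 0
          have h1 := b1 1
          have h2 := b1 (-1)
          have e1 : (2:ℝ) ^ ((1:ℝ) - 0 + 0 - 0) = 2 := by norm_num
          rw [e1]
          rcases st' (f y * c y z) with h' | h' | h'
          · exact absurd h' h
          · have n2 : ¬ ∀ y ∈ T, f y * c y z * (-1) ≠ -1 := fun hh => hh y hy (by rw [h']; decide)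
            rw [if_neg n2]
            linarith
          · have n1 : ¬ ∀ y ∈ T, f y * c y z * 1 ≠ -1 := fun hh => hh y hy (by rw [h']; decide)
            rw [if_neg n1]
            linarith
  have H2 : ∑ h : V → SignType, ∏ z, g z (h z) ≤ 2 ^ (∑ z, e z) := by
    have := (Finset.prod_univ_sum (fun _ : V => (univ : Finset SignType)) g)
    rw [Fintype.piFinset_univ] at this
    rw [← this, Real.rpow_sum_of_pos (by norm_num)]
    exact prod_le_prod (fun z _ => sum_nonneg fun a _ => g0 z a) fun z _ => H1 z
  have H3 : ∀ h ∈ rows c R T f, (2:ℝ) ^ (-(7/128 * (R.card : ℝ))) ≤ ∏ z, g z (h z) := by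
    intro h hh
    simp only [rows, mem_filter, mem_univ, true_and] at hh
    have : ∏ z, g z (h z) = ∏ z, if z ∈ ((univ.filter fun z => h z ≠ 0) ∩ R) then (1/128 : ℝ) else 1 := by
      apply prod_congr rfl
      intro z _
      simp only [g, mem_inter, mem_filter, mem_univ, true_and]
      have := hh.2 z
      by_cases hR : z ∈ R
      · by_cases h0 : h z = 0 <;> simp [hR, h0]
      · simp only [hR, if_false, and_false]
        rw [if_pos this]
    rw [this, prod_ite_mem, univ_inter, prod_const]
    set m := ((univ.filter fun z => h z ≠ 0) ∩ R).card
    have hm : 128 * (m : ℝ) ≤ R.card := by exact_mod_cast hh.1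
    have e1 : (1/128 : ℝ)^m = 2 ^ (-(7 * (m:ℝ))) := by
      rw [Real.rpow_neg (by norm_num), Real.rpow_mul (by norm_num), Real.rpow_natCast, one_div, inv_pow]
      norm_num
    rw [e1]
    apply Real.rpow_le_rpow_of_exponent_le (by norm_num)
    linarith
  have H4 : ∑ z, e z = (Fintype.card V : ℝ) - 31/32 * R.card
      + 3/5 * (unc f c T \ R).card - (cnf f c T \ R).card := by
    simp only [e, sum_add_distrib, sum_sub_distrib, sum_ite_mem, univ_inter, sum_const,
      nsmul_eq_mul, card_univ]
    ring
  have H5 : ((rows c R T f).card : ℝ) * (2:ℝ) ^ (-(7/128 * (R.card : ℝ))) ≤ 2 ^ (∑ z, e z) := by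
    refine le_trans ?_ H2
    rw [← nsmul_eq_mul, ← sum_const]
    refine (sum_le_sum H3).trans (sum_le_univ_sum_of_nonneg fun h => prod_nonneg fun z _ => g0 _ _)
  rw [Real.rpow_neg (by norm_num), ← div_eq_mul_inv, div_le_iff₀ (by positivity),
    ← Real.rpow_add (by norm_num), H4] at H5
  refine H5.trans (Real.rpow_le_rpow_of_exponent_le (by norm_num) ?_)
  have : (0:ℝ) ≤ R.card := by positivity
  linarith

/-- Rows with few options. -/
def opt (k : ℕ) (X : ℝ) (c : V → V → SignType) (R : Finset V) : Finset (V → SignType) :=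
  univ.filter fun g => 128 * ((univ.filter fun z => g z ≠ 0) ∩ R).card ≤ R.card ∧
    ∃ T : Finset V, T.card ≤ k ∧ (∀ z, ∀ y ∈ T, g y * c y z * g z ≠ -1) ∧
      6 * ((unc g c T \ R).card : ℝ) + X ≤ 9 * (R.card : ℝ) + 10 * ((cnf g c T \ R).card : ℝ)

lemma card_small (k : ℕ) (hV : 0 < Fintype.card V) :
    (univ.filter fun T : Finset V => T.card ≤ k).card ≤ (k+1) * Fintype.card V ^ k := by
  have hsub : (univ.filter fun T : Finset V => T.card ≤ k) ⊆
      (range (k+1)).biUnion fun i => powersetCard i univ := by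
    intro T hT
    simp only [mem_filter, mem_univ, true_and] at hT
    simp only [mem_biUnion, mem_range, mem_powersetCard, subset_univ, true_and]
    exact ⟨T.card, by omega, rfl⟩
  refine (card_le_card hsub).trans ((card_biUnion_le_card_mul _ _ (Fintype.card V ^ k) ?_).trans ?_)
  · intro i hi
    rw [card_powersetCard, card_univ]
    exact (Nat.choose_le_pow _ _).trans (Nat.pow_le_pow_right hV (by simp at hi; omega))
  · rw [card_range]

lemma opt_card (k : ℕ) (X : ℝ) (c : V → V → SignType) (R : Finset V) (hV : 0 < Fintype.card V) :
    ((opt k X c R).card : ℝ) ≤ ((k+1) * Fintype.card V ^ k * 3 ^ k : ℝ)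
      * 2 ^ ((Fintype.card V : ℝ) - X / 10) := by
  let good : Finset V → (V → SignType) → Prop := fun T f =>
    6 * ((unc f c T \ R).card : ℝ) + X ≤ 9 * (R.card : ℝ) + 10 * ((cnf f c T \ R).card : ℝ)
  let P : Finset V → Finset (V → SignType) := fun T =>
    (Fintype.piFinset fun z => if z ∈ T then (univ : Finset SignType) else {0}).filter (good T)
  let D : Finset (Σ _ : Finset V, V → SignType) := (univ.filter fun T : Finset V => T.card ≤ k).sigma P
  have hsub : opt k X c R ⊆ D.biUnion fun d => rows c R d.1 d.2 := by
    intro g hg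
    simp only [opt, mem_filter, mem_univ, true_and] at hg
    obtain ⟨h1, T, hT, h2, h3⟩ := hg
    rw [mem_biUnion]
    let f : V → SignType := fun z => if z ∈ T then g z else 0
    have hf : ∀ y ∈ T, f y = g y := fun y hy => by simp [f, hy]
    refine ⟨⟨T, f⟩, ?_, ?_⟩
    · simp only [D, P, mem_sigma, mem_filter, mem_univ, true_and, Fintype.mem_piFinset]
      refine ⟨hT, fun z => ?_, ?_⟩
      · by_cases hz : z ∈ T <;> simp [f, hz]
      · have e1 : unc f c T = unc g c T := by
          unfold unc
          apply filter_congr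
          intro z _
          exact forall₂_congr fun y hy => by rw [hf y hy]
        have e2 : cnf f c T = cnf g c T := by
          unfold cnf
          apply filter_congr
          intro z _
          refine and_congr ?_ ?_ <;>
          · refine exists_congr fun y => and_congr_right fun hy => ?_
            rw [hf y hy]
        simp only [good, e1, e2]
        exact h3
    · simp only [rows, mem_filter, mem_univ, true_and]
      exact ⟨h1, fun z y hy => by rw [hf y hy]; exact h2 z y hy⟩
  have hD : (D.card : ℝ) ≤ ((k+1) * Fintype.card V ^ k * 3 ^ k : ℝ) := by
    have : D.card ≤ (k+1) * Fintype.card V ^ k * 3 ^ k := by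
      rw [card_sigma]
      calc ∑ T ∈ (univ.filter fun T : Finset V => T.card ≤ k), (P T).card
          ≤ ∑ T ∈ (univ.filter fun T : Finset V => T.card ≤ k), 3 ^ k := by
            apply sum_le_sum
            intro T hT
            simp only [mem_filter, mem_univ, true_and] at hT
            refine (card_filter_le _ _).trans ?_
            rw [Fintype.card_piFinset]
            have : ∀ z, (if z ∈ T then (univ : Finset SignType) else {0}).card
                = if z ∈ T then 3 else 1 := by
              intro z; split_ifs <;> simp <;> rfl
            simp only [this]
            rw [prod_ite_mem, univ_inter, prod_const]
            exact Nat.pow_le_pow_right (by norm_num) hT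
        _ ≤ _ := by
            rw [sum_const, smul_eq_mul]
            exact Nat.mul_le_mul_right _ (card_small k hV)
    exact_mod_cast this
  have h1 : ((opt k X c R).card : ℝ) ≤ ∑ d ∈ D, ((rows c R d.1 d.2).card : ℝ) := by
    exact_mod_cast (card_le_card hsub).trans card_biUnion_le
  have h2 : ∑ d ∈ D, ((rows c R d.1 d.2).card : ℝ) ≤ ∑ d ∈ D, 2 ^ ((Fintype.card V : ℝ) - X / 10) := by
    apply sum_le_sum
    intro d hd
    refine (rows_card c R d.1 d.2).trans (Real.rpow_le_rpow_of_exponent_le (by norm_num) ?_)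
    simp only [D, P, mem_sigma, mem_filter, good] at hd
    have := hd.2.2
    linarith
  refine h1.trans (h2.trans ?_)
  rw [sum_const, nsmul_eq_mul]
  exact mul_le_mul_of_nonneg_right hD (by positivity)

/-- All configurations. -/
def FS (V : Type*) [Fintype V] : Finset (V → V → SignType) := univ.filter OK

lemma OK_comap {V W : Type*} (g : W → V) (c : V → V → SignType) (hc : OK c) :
    OK (fun x y => c (g x) (g y)) :=
  ⟨fun _ _ => hc.1 _ _, fun _ => hc.2.1 _, fun _ _ _ => hc.2.2 _ _ _⟩

lemma FS_card (W : Type*) [Fintype W] (m : ℕ) (h : Fintype.card W = m) :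
    (FS W).card ≤ (FS (Fin m)).card := by
  let e : Fin m ≃ W := (Fintype.equivFinOfCardEq h).symm
  refine card_le_card_of_injOn (fun c x y => c (e x) (e y)) ?_ ?_
  · intro c hc
    simp only [FS, mem_coe, mem_filter, mem_univ, true_and] at hc ⊢
    exact OK_comap e c hc
  · intro c _ c' _ h
    funext x y
    have := congrFun (congrFun h (e.symm x)) (e.symm y)
    simpa using this

/-- Configurations with bad set `Q`. -/
def SQ (k : ℕ) (e : ℝ) (R Q : Finset V) : Finset (V → V → SignType) :=
  (FS V).filter fun c => ∀ x ∈ Q, 128 * (nb c x ∩ R).card ≤ R.card ∧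
    ∃ T, Disjoint T Q ∧ IsBadT k e (c x) c R T

lemma SQ_card (k : ℕ) (e : ℝ) (R Q : Finset V) (hV : 0 < Fintype.card V) :
    ((SQ k e R Q).card : ℝ) ≤ (FS (Fin (Fintype.card V - Q.card))).card *
      (((k+1) * Fintype.card V ^ k * 3 ^ k : ℝ)
      * 2 ^ ((Fintype.card V : ℝ) - (e * Fintype.card V - 16 * Q.card) / 10)) ^ Q.card := by
  set M : ℝ := ((k+1) * Fintype.card V ^ k * 3 ^ k : ℝ)
      * 2 ^ ((Fintype.card V : ℝ) - (e * Fintype.card V - 16 * Q.card) / 10) with hM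
  let W := {v : V // v ∉ Q}
  let r : (V → V → SignType) → (W → W → SignType) := fun c x y => c x y
  have hW : Fintype.card W = Fintype.card V - Q.card := by
    simp only [W]
    rw [Fintype.card_subtype_compl, Fintype.card_coe]
  have hfib : ∀ a ∈ (SQ k e R Q).image r,
      (((SQ k e R Q).filter fun c => r c = a).card : ℝ) ≤ M ^ Q.card := by
    intro a ha
    let c0 : V → V → SignType := fun y z => if h : y ∉ Q ∧ z ∉ Q then a ⟨y, h.1⟩ ⟨z, h.2⟩ else 0
    have hinj : ((SQ k e R Q).filter fun c => r c = a).card ≤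
        (Fintype.piFinset fun _ : Q => opt k (e * Fintype.card V - 16 * Q.card) c0 R).card := by
      refine card_le_card_of_injOn (fun c x => c x) ?_ ?_
      · intro c hc
        simp only [mem_coe, mem_filter, SQ, FS, mem_univ, true_and] at hc
        obtain ⟨⟨hok, hbad⟩, hr⟩ := hc
        simp only [mem_coe, Fintype.mem_piFinset]
        rintro ⟨x, hx⟩
        obtain ⟨h1, T, hTQ, hTk, h2⟩ := hbad x hx
        have hc0 : ∀ y z, y ∉ Q → z ∉ Q → c0 y z = c y z := by
          intro y z hy hz
          simp only [c0, hy, hz, not_false_eq_true, and_self, dif_pos, ← hr, r]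
        have hc1 : ∀ y z, z ∈ Q → c0 y z = 0 := by
          intro y z hz
          simp [c0, hz]
        have hTQ' : ∀ y ∈ T, y ∉ Q := fun y hy => disjoint_left.1 hTQ hy
        simp only [opt, mem_filter, mem_univ, true_and]
        refine ⟨h1, T, hTk, ?_, ?_⟩
        · intro z y hy
          by_cases hz : z ∈ Q
          · rw [hc1 y z hz, mul_zero, zero_mul]; decide
          · rw [hc0 y z (hTQ' y hy) hz]
            exact hok.2.2 x y z
        · have s1 : unc (c x) c0 T \ R ⊆ (unc (c x) c T \ R) ∪ Q := by
            intro z hz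
            rw [mem_union, Finset.mem_sdiff]
            rw [Finset.mem_sdiff] at hz
            by_cases hzQ : z ∈ Q
            · exact Or.inr hzQ
            · refine Or.inl ⟨?_, hz.2⟩
              have := hz.1
              simp only [unc, mem_filter, mem_univ, true_and] at this ⊢
              intro y hy
              rw [← hc0 y z (hTQ' y hy) hzQ]
              exact this y hy
          have s2 : cnf (c x) c T \ R ⊆ (cnf (c x) c0 T \ R) ∪ Q := by
            intro z hz
            rw [mem_union, Finset.mem_sdiff]
            rw [Finset.mem_sdiff] at hz
            by_cases hzQ : z ∈ Q
            · exact Or.inr hzQ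
            · refine Or.inl ⟨?_, hz.2⟩
              have := hz.1
              simp only [cnf, mem_filter, mem_univ, true_and] at this ⊢
              obtain ⟨⟨y, hy, h⟩, y', hy', h'⟩ := this
              exact ⟨⟨y, hy, by rw [hc0 y z (hTQ' y hy) hzQ]; exact h⟩,
                y', hy', by rw [hc0 y' z (hTQ' y' hy') hzQ]; exact h'⟩
          have t1 : ((unc (c x) c0 T \ R).card : ℝ) ≤ (unc (c x) c T \ R).card + Q.card := by
            exact_mod_cast (card_le_card s1).trans (card_union_le _ _)
          have t2 : ((cnf (c x) c T \ R).card : ℝ) ≤ (cnf (c x) c0 T \ R).card + Q.card := by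
            exact_mod_cast (card_le_card s2).trans (card_union_le _ _)
          linarith
      · intro c hc c' hc' heq
        simp only [mem_coe, mem_filter, SQ, FS, mem_univ, true_and] at hc hc'
        funext x y
        by_cases hx : x ∈ Q
        · exact congrFun (congrFun heq ⟨x, hx⟩) y
        · by_cases hy : y ∈ Q
          · rw [hc.1.1.1, hc'.1.1.1 x y]
            exact congrFun (congrFun heq ⟨y, hy⟩) x
          · exact congrFun (congrFun (hc.2.trans hc'.2.symm) ⟨x, hx⟩) ⟨y, hy⟩
    rw [Fintype.card_piFinset, prod_const, card_univ, Fintype.card_coe] at hinj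
    have h3 : (((SQ k e R Q).filter fun c => r c = a).card : ℝ) ≤
      ((opt k (e * Fintype.card V - 16 * Q.card) c0 R).card : ℝ) ^ Q.card := by exact_mod_cast hinj
    refine h3.trans (pow_le_pow_left₀ (by positivity) ?_ _)
    exact opt_card k _ c0 R hV
  have himg : ((SQ k e R Q).image r).card ≤ (FS (Fin (Fintype.card V - Q.card))).card := by
    refine le_trans (card_le_card ?_) (FS_card W _ hW)
    intro a ha
    rw [mem_image] at ha
    obtain ⟨c, hc, rfl⟩ := ha
    simp only [SQ, FS, mem_filter, mem_univ, true_and] at hc ⊢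
    exact OK_comap _ c hc.1
  have h4 : ((SQ k e R Q).card : ℝ) = ∑ a ∈ (SQ k e R Q).image r,
      (((SQ k e R Q).filter fun c => r c = a).card : ℝ) := by
    exact_mod_cast card_eq_sum_card_image r (SQ k e R Q)
  rw [h4]
  refine (sum_le_sum hfib).trans ?_
  rw [sum_const, nsmul_eq_mul]
  have hM0 : 0 ≤ M := by positivity
  exact mul_le_mul_of_nonneg_right (by exact_mod_cast himg) (by positivity)

lemma indep (k : ℕ) (T : V → Finset V) (q : ℕ) : ∀ S : Finset V, (∀ x ∈ S, (T x).card ≤ k ∧ x ∉ T x) →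
    (2 * k + 1) * q < S.card + (2 * k + 1) →
    ∃ Q ⊆ S, Q.card = q ∧ ∀ x ∈ Q, Disjoint (T x) Q := by
  induction q with
  | zero => exact fun S _ _ => ⟨∅, by simp, by simp, by simp⟩
  | succ q ih =>
    intro S hS hq
    have hpos : 0 < S.card := by
      rw [Nat.mul_succ] at hq
      by_contra h
      have : S.card = 0 := by omega
      rw [this] at hq
      have : 0 ≤ (2 * k + 1) * q := Nat.zero_le _
      omega
    have hex : ∃ x ∈ S, (S.filter fun y => x ∈ T y).card ≤ k := by
      by_contra hcon
      push Not at hcon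
      have h1 : ∑ x ∈ S, (S.filter fun y => x ∈ T y).card = ∑ y ∈ S, (S.filter fun x => x ∈ T y).card := by
        simp only [card_filter]
        rw [sum_comm]
      have h2 : ∑ y ∈ S, (S.filter fun x => x ∈ T y).card ≤ ∑ y ∈ S, k := by
        apply sum_le_sum
        intro y hy
        refine le_trans (card_le_card ?_) (hS y hy).1
        intro x hx
        exact (mem_filter.1 hx).2
      have h3 : ∑ x ∈ S, (k + 1) ≤ ∑ x ∈ S, (S.filter fun y => x ∈ T y).card :=
        sum_le_sum fun x hx => hcon x hx
      rw [h1] at h3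
      have h4 := h3.trans h2
      simp only [sum_const, smul_eq_mul] at h4
      have := Nat.le_of_mul_le_mul_left h4 hpos
      omega
    obtain ⟨x, hx, hxk⟩ := hex
    set S' := S \ (insert x (T x ∪ S.filter fun y => x ∈ T y)) with hS'
    have hc1 : (insert x (T x ∪ S.filter fun y => x ∈ T y)).card ≤ 2 * k + 1 := by
      refine (card_insert_le _ _).trans ?_
      have := card_union_le (T x) (S.filter fun y => x ∈ T y)
      have := (hS x hx).1
      omega
    have hc2 : S.card ≤ S'.card + (2 * k + 1) := by
      have := le_card_sdiff (insert x (T x ∪ S.filter fun y => x ∈ T y)) S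
      rw [← hS'] at this
      omega
    obtain ⟨Q, hQ, hQc, hQd⟩ := ih S' (fun y hy => hS y (Finset.mem_sdiff.1 hy).1) (by
      rw [Nat.mul_succ] at hq; omega)
    have hmem : ∀ y ∈ Q, y ∈ S ∧ y ≠ x ∧ y ∉ T x ∧ x ∉ T y := by
      intro y hy
      have := hQ hy
      rw [hS', Finset.mem_sdiff] at this
      simp only [mem_insert, mem_union, mem_filter, not_or, not_and] at this
      exact ⟨this.1, this.2.1, this.2.2.1, this.2.2.2 this.1⟩
    have hxQ : x ∉ Q := fun h => (hmem x h).2.1 rfl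
    refine ⟨insert x Q, ?_, ?_, ?_⟩
    · intro y hy
      rcases mem_insert.1 hy with rfl | hy
      · exact hx
      · exact (hmem y hy).1
    · rw [card_insert_of_notMem hxQ, hQc]
    · intro y hy
      rw [disjoint_insert_right]
      rcases mem_insert.1 hy with rfl | hy
      · refine ⟨(hS _ hx).2, ?_⟩
        rw [disjoint_right]
        exact fun z hz => (hmem z hz).2.2.1
      · exact ⟨(hmem y hy).2.2.2, hQd y hy⟩

lemma bad_erase (k : ℕ) (e : ℝ) (c : V → V → SignType) (hc : OK c) (R : Finset V) (x : V)
    (T : Finset V) (h : IsBadT k e (c x) c R T) : IsBadT k e (c x) c R (T.erase x) := by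
  have key : ∀ z, c x x * c x z = 0 := fun z => by rw [hc.2.1, zero_mul]
  have e1 : unc (c x) c (T.erase x) = unc (c x) c T := by
    unfold unc
    apply filter_congr
    intro z _
    constructor
    · intro h y hy
      by_cases hyx : y = x
      · rw [hyx]; exact key z
      · exact h y (mem_erase.2 ⟨hyx, hy⟩)
    · exact fun h y hy => h y (mem_of_mem_erase hy)
  have e3 : ∀ z, ∀ s : SignType, s ≠ 0 →
      ((∃ y ∈ T.erase x, c x y * c y z = s) ↔ ∃ y ∈ T, c x y * c y z = s) := by
    intro z s hs
    constructor
    · rintro ⟨y, hy, h⟩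
      exact ⟨y, mem_of_mem_erase hy, h⟩
    · rintro ⟨y, hy, h⟩
      refine ⟨y, mem_erase.2 ⟨?_, hy⟩, h⟩
      rintro rfl
      rw [key z] at h
      exact hs h.symm
  have e2 : cnf (c x) c (T.erase x) = cnf (c x) c T := by
    unfold cnf
    apply filter_congr
    intro z _
    rw [e3 z 1 (by decide), e3 z (-1) (by decide)]
  refine ⟨(card_le_card (erase_subset _ _)).trans h.1, ?_⟩
  rw [e1, e2]
  exact h.2

/-- Configurations with many bad vertices. -/
def manyBad (V : Type*) [Fintype V] (k : ℕ) (e : ℝ) (R : Finset V) (q : ℕ) :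
    Finset (V → V → SignType) :=
  (FS V).filter fun c => (2 * k + 1) * q < (badSet k e c R).card + (2 * k + 1)

lemma manyBad_card (k : ℕ) (e : ℝ) (R : Finset V) (q : ℕ) (hV : 0 < Fintype.card V) :
    ((manyBad V k e R q).card : ℝ) ≤ Fintype.card V ^ q *
      ((FS (Fin (Fintype.card V - q))).card *
      (((k+1) * Fintype.card V ^ k * 3 ^ k : ℝ)
      * 2 ^ ((Fintype.card V : ℝ) - (e * Fintype.card V - 16 * q) / 10)) ^ q) := by
  have hsub : manyBad V k e R q ⊆ (powersetCard q univ).biUnion fun Q => SQ k e R Q := by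
    intro c hc
    simp only [manyBad, mem_filter] at hc
    obtain ⟨hF, hq⟩ := hc
    have hok : OK c := by simpa [FS] using hF
    have hch : ∀ x, ∃ T, x ∈ badSet k e c R → IsBadT k e (c x) c R T ∧ x ∉ T := by
      intro x
      by_cases hx : x ∈ badSet k e c R
      · have hx' := hx
        simp only [badSet, mem_filter, mem_univ, true_and] at hx'
        obtain ⟨_, T, hT⟩ := hx'
        exact ⟨T.erase x, fun _ => ⟨bad_erase k e c hok R x T hT, notMem_erase _ _⟩⟩
      · exact ⟨∅, fun h => absurd h hx⟩
    choose T hT using hch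
    obtain ⟨Q, hQ, hQc, hQd⟩ := indep k T q (badSet k e c R)
      (fun x hx => ⟨(hT x hx).1.1, (hT x hx).2⟩) hq
    rw [mem_biUnion]
    refine ⟨Q, by simp [hQc], ?_⟩
    simp only [SQ, mem_filter]
    refine ⟨hF, fun x hx => ⟨?_, T x, hQd x hx, (hT x (hQ hx)).1⟩⟩
    have := hQ hx
    simp only [badSet, mem_filter, mem_univ, true_and] at this
    exact this.1
  set M := ((FS (Fin (Fintype.card V - q))).card *
      (((k+1) * Fintype.card V ^ k * 3 ^ k : ℝ)
      * 2 ^ ((Fintype.card V : ℝ) - (e * Fintype.card V - 16 * q) / 10)) ^ q) with hM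
  have h1 : ((manyBad V k e R q).card : ℝ) ≤ ∑ Q ∈ powersetCard q (univ : Finset V), ((SQ k e R Q).card : ℝ) := by
    exact_mod_cast (card_le_card hsub).trans card_biUnion_le
  have h2 : ∑ Q ∈ powersetCard q (univ : Finset V), ((SQ k e R Q).card : ℝ) ≤
      ∑ Q ∈ powersetCard q (univ : Finset V), M := by
    apply sum_le_sum
    intro Q hQ
    have := (mem_powersetCard.1 hQ).2
    subst this
    exact SQ_card k e R Q hV
  refine h1.trans (h2.trans ?_)
  rw [sum_const, nsmul_eq_mul, card_powersetCard, card_univ]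
  have hM0 : 0 ≤ M := by positivity
  exact mul_le_mul_of_nonneg_right (by exact_mod_cast Nat.choose_le_pow _ _) hM0

/-- Configurations at distance at least `t` from balanced. -/
def Sf (n t : ℕ) : Finset (Fin n → Fin n → SignType) :=
  (FS (Fin n)).filter fun c => ∀ D, BalOff c D → t ≤ D.card

lemma bnum_eq (m : ℕ) (hm : 1 ≤ m) : (bnum m : ℝ) = 2 ^ ((m : ℝ) * (m + 1) / 2 - 1) := by
  unfold bnum
  have h2 : 2 ∣ m * (m + 1) := (Nat.even_mul_succ_self m).two_dvd
  have h1 : 1 ≤ m * (m + 1) / 2 := by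
    rw [Nat.le_div_iff_mul_le (by norm_num)]
    nlinarith
  push_cast
  rw [← Real.rpow_natCast, Nat.cast_sub h1, Nat.cast_div h2 (by norm_num)]
  push_cast
  rfl

lemma ep_pos : 0 < ep := by norm_num [ep]

lemma manyBad_card' {V : Type} [Fintype V] (k : ℕ) (e : ℝ) (R : Finset V) (q n : ℕ) (hV : 0 < n)
    (hn : Fintype.card V = n) :
    ((manyBad V k e R q).card : ℝ) ≤ (n : ℝ) ^ q * (((FS (Fin (n - q))).card : ℝ) *
        (((k+1) * n ^ k * 3 ^ k : ℝ) * 2 ^ ((n : ℝ) - (e * n - 16 * q) / 10)) ^ q) := by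
  subst hn
  exact manyBad_card k e R q hV

lemma det_main' {V : Type} [Fintype V] (c : V → V → SignType) (hc : OK c) (k : ℕ)
    (hk : (127/128 : ℝ)^k < ep)
    (hmu : ∀ R, ((badSet (k+1) ep c R).card : ℝ) ≤ 1/2^20 * Fintype.card V) (t : ℕ)
    (hD : ∀ D, BalOff c D → t ≤ D.card) :
    t ≤ (badSet (k+1) ep c ∅).card + (badSet (k+1) ep c univ).card :=
  (hD _ (det_main c hc k hk hmu)).trans (card_union_le _ _)

lemma asym (k : ℕ) : ∃ N : ℕ, ∀ n : ℕ, N ≤ n → ∀ q : ℕ, (q : ℝ) ≤ ep / 100 * n → ∀ A : ℝ, 0 ≤ A →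
    ((FS (Fin (n - q))).card : ℝ) ≤ A * bnum (n - q) → ∀ R : Finset (Fin n),
    ((manyBad (Fin n) k ep R q).card : ℝ) ≤ A * bnum n * 2 ^ (-(ep / 20 * n * q)) := by
  have hr : (1:ℝ) < 2 ^ (ep / 40) := Real.one_lt_rpow (by norm_num) (by have := ep_pos; positivity)
  have ho := isLittleO_pow_const_const_pow_of_one_lt (R := ℝ) (k + 1) hr
  have hpos : (0:ℝ) < 1 / ((k+1) * 3 ^ k) := by positivity
  have hev := ho.bound hpos
  obtain ⟨N, hN⟩ := eventually_atTop.1 hev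
  refine ⟨max N 1, fun n hn q hq A hA hF R => ?_⟩
  have hn1 : 1 ≤ n := (le_max_right _ _).trans hn
  have h1 := hN n ((le_max_left _ _).trans hn)
  have hM : (n : ℝ) * ((k+1) * n ^ k * 3 ^ k : ℝ) ≤ 2 ^ (ep / 40 * n) := by
    rw [Real.norm_of_nonneg (by positivity), Real.norm_of_nonneg (by positivity), one_div,
      ← Real.rpow_natCast (2 ^ (ep/40)), ← Real.rpow_mul (by norm_num), inv_mul_eq_div,
      le_div_iff₀ (by positivity)] at h1
    calc (n : ℝ) * ((k+1) * n ^ k * 3 ^ k : ℝ) = n ^ (k+1) * ((k+1) * 3 ^ k) := by ring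
      _ ≤ _ := h1
  have hnr : (1:ℝ) ≤ n := by exact_mod_cast hn1
  have hqn : q < n := by
    have : (q:ℝ) < n := by
      have : ep / 100 < 1 := by norm_num [ep]
      nlinarith
    exact_mod_cast this
  have hb := manyBad_card' k ep R q n hn1 (Fintype.card_fin n)
  refine hb.trans ?_
  have hE : (n : ℝ) * (((k+1) * n ^ k * 3 ^ k : ℝ) * 2 ^ ((n : ℝ) - (ep * n - 16 * q) / 10)) ≤
      2 ^ (ep / 40 * n + ((n : ℝ) - (ep * n - 16 * q) / 10)) := by
    rw [Real.rpow_add (by norm_num), ← mul_assoc]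
    exact mul_le_mul_of_nonneg_right hM (by positivity)
  calc (n : ℝ) ^ q * (((FS (Fin (n - q))).card : ℝ) *
        (((k+1) * n ^ k * 3 ^ k : ℝ) * 2 ^ ((n : ℝ) - (ep * n - 16 * q) / 10)) ^ q)
      = ((FS (Fin (n - q))).card : ℝ) *
        ((n : ℝ) * (((k+1) * n ^ k * 3 ^ k : ℝ) * 2 ^ ((n : ℝ) - (ep * n - 16 * q) / 10))) ^ q := by
          rw [mul_pow (n : ℝ)]; ring
    _ ≤ (A * bnum (n - q)) * (2 ^ (ep / 40 * n + ((n : ℝ) - (ep * n - 16 * q) / 10))) ^ q := by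
          refine mul_le_mul hF (pow_le_pow_left₀ (by positivity) hE _) (by positivity) (by positivity)
    _ ≤ _ := by
          rw [mul_assoc, mul_assoc]
          refine mul_le_mul_of_nonneg_left ?_ hA
          rw [bnum_eq (n - q) (by omega), bnum_eq n hn1, ← Real.rpow_natCast _ q,
            ← Real.rpow_mul (by norm_num), ← Real.rpow_add (by norm_num),
            ← Real.rpow_add (by norm_num)]
          apply Real.rpow_le_rpow_of_exponent_le (by norm_num)
          rw [Nat.cast_sub hqn.le]
          have hq0 : (0:ℝ) ≤ q := by positivity
          have key : (q:ℝ) * (-(ep / 40 * n) + 2.1 * q - 1/2) ≤ 0 := by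
            apply mul_nonpos_of_nonneg_of_nonpos hq0
            have := ep_pos
            nlinarith
          nlinarith

lemma main_count : ∃ g : ℝ, 0 < g ∧ ∃ τ : ℝ, 0 < τ ∧ ∃ N : ℕ, ∀ n : ℕ, N ≤ n → ∀ t : ℕ, 1 ≤ t →
    (t : ℝ) ≤ τ * n → ∀ A : ℝ, 0 ≤ A → (∀ m < n, ((FS (Fin m)).card : ℝ) ≤ A * bnum m) →
    ((Sf n t).card : ℝ) ≤ 3 * A * bnum n * 2 ^ (-(g * n * t)) := by
  obtain ⟨k0, hk0⟩ := exists_pow_lt_of_lt_one ep_pos (show (127/128 : ℝ) < 1 by norm_num)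
  set k := k0 + 1 with hk
  set L := 2 * k + 1 with hL
  obtain ⟨N, hN⟩ := asym k
  have hep := ep_pos
  have hep1 : ep ≤ 1 := by norm_num [ep]
  have hLpos : (1:ℝ) ≤ L := by
    have : 1 ≤ L := by omega
    exact_mod_cast this
  obtain ⟨K, hK⟩ := exists_nat_gt (40 / ep)
  have hK' : 40 < ep * K := by
    rw [div_lt_iff₀ hep] at hK; linarith
  have hKpos : (1:ℝ) ≤ K := by nlinarith
  refine ⟨ep / (40 * L), by positivity, ep / (2^21 * L * K), by positivity, max N 1,
    fun n hn t ht htn A hA hF => ?_⟩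
  have hn1 : 1 ≤ n := (le_max_right _ _).trans hn
  have hnr : (1:ℝ) ≤ n := by exact_mod_cast hn1
  have htr : (1:ℝ) ≤ t := by exact_mod_cast ht
  have hNn := hN n ((le_max_left _ _).trans hn)
  -- the two sizes
  set q1 := (t - 1) / (2 * L) + 1 with hq1
  set q2 := K * t with hq2
  have htn' : 2^21 * L * K * t ≤ ep * n := by
    rw [div_mul_eq_mul_div, le_div_iff₀ (by positivity)] at htn
    linarith
  have hLK : (K:ℝ) * t ≤ L * K * t := by
    rw [mul_assoc (L:ℝ)]
    exact le_mul_of_one_le_left (by positivity) hLpos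
  have hKt : (t:ℝ) ≤ K * t := le_mul_of_one_le_left (by positivity) hKpos
  have hq1t : q1 ≤ t := by
    have : (t - 1) / (2 * L) ≤ t - 1 := Nat.div_le_self _ _
    omega
  have hq1L : t ≤ 2 * L * q1 := by
    have h := Nat.lt_mul_div_succ (t - 1) (show 0 < 2 * L by omega)
    change t - 1 < 2 * L * q1 at h
    omega
  have hq1L' : 2 * (L * q1) < t + 2 * L := by
    have h := Nat.div_mul_le_self (t - 1) (2 * L)
    have e : 2 * (L * q1) = (t - 1) / (2 * L) * (2 * L) + 2 * L := by rw [hq1]; ring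
    omega
  have b1 : ∀ R : Finset (Fin n), ((manyBad (Fin n) k ep R q1).card : ℝ) ≤
      A * bnum n * 2 ^ (-(ep / (40 * L) * n * t)) := by
    intro R
    have hq1r : (q1:ℝ) ≤ t := by exact_mod_cast hq1t
    have hq1p : 1 ≤ q1 := Nat.le_add_left 1 _
    refine (hNn q1 (by linarith) A hA (hF _ (by omega)) R).trans ?_
    refine mul_le_mul_of_nonneg_left ?_ (by positivity)
    apply Real.rpow_le_rpow_of_exponent_le (by norm_num)
    have h : (t:ℝ) ≤ 2 * L * q1 := by exact_mod_cast hq1L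
    have e1 : ep / (40 * L) * n * t ≤ ep / (40 * L) * n * (2 * L * q1) :=
      mul_le_mul_of_nonneg_left h (by positivity)
    have e2 : ep / (40 * L) * n * (2 * L * q1) = ep / 20 * n * q1 := by
      field_simp
      ring
    linarith
  have b2 : ∀ R : Finset (Fin n), ((manyBad (Fin n) k ep R q2).card : ℝ) ≤
      A * bnum n * 2 ^ (-(2 * (n:ℝ) * t)) := by
    intro R
    have hq2p : 1 ≤ q2 := by
      have : (1:ℝ) ≤ q2 := by rw [hq2]; push_cast; linarith
      exact_mod_cast this
    refine (hNn q2 (by rw [hq2]; push_cast; linarith) A hA (hF _ (by omega)) R).trans ?_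
    refine mul_le_mul_of_nonneg_left ?_ (by positivity)
    apply Real.rpow_le_rpow_of_exponent_le (by norm_num)
    rw [hq2]
    push_cast
    have : (0:ℝ) ≤ (n:ℝ) * t := by positivity
    nlinarith
  have hsub : Sf n t ⊆ (manyBad (Fin n) k ep ∅ q1 ∪ manyBad (Fin n) k ep univ q1) ∪
      (univ : Finset (Finset (Fin n))).biUnion fun R => manyBad (Fin n) k ep R q2 := by
    intro c hc
    simp only [Sf, mem_filter] at hc
    obtain ⟨hcF, hD⟩ := hc
    have hok : OK c := by simpa [FS] using hcF
    simp only [mem_union, mem_biUnion, mem_univ, true_and, manyBad, mem_filter, hcF]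
    by_cases hall : ∀ R, ((badSet k ep c R).card : ℝ) ≤ 1/2^20 * Fintype.card (Fin n)
    · left
      have h1 := det_main' c hok k0 hk0 hall t hD
      rw [← hk] at h1
      by_contra hcon
      rw [not_or, not_lt, not_lt, ← hL] at hcon
      omega
    · right
      push Not at hall
      obtain ⟨R, hR⟩ := hall
      refine ⟨R, ?_⟩
      rw [Fintype.card_fin] at hR
      have : ((2 * k + 1 : ℕ) : ℝ) * q2 < (badSet k ep c R).card := by
        rw [← hL, hq2]
        push_cast
        nlinarith
      have : (2 * k + 1) * q2 < (badSet k ep c R).card := by exact_mod_cast this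
      omega
  have h1 : ((Sf n t).card : ℝ) ≤ ((manyBad (Fin n) k ep ∅ q1).card +
      (manyBad (Fin n) k ep univ q1).card) + ∑ R : Finset (Fin n), ((manyBad (Fin n) k ep R q2).card : ℝ) := by
    exact_mod_cast (card_le_card hsub).trans ((card_union_le _ _).trans
      (add_le_add (card_union_le _ _) card_biUnion_le))
  have h2 : ∑ R : Finset (Fin n), ((manyBad (Fin n) k ep R q2).card : ℝ) ≤
      A * bnum n * 2 ^ (-(ep / (40 * L) * n * t)) := by
    refine (sum_le_sum fun R _ => b2 R).trans ?_
    rw [sum_const, card_univ, Fintype.card_finset, Fintype.card_fin, nsmul_eq_mul]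
    push_cast
    have e : (2:ℝ) ^ n * (A * bnum n * 2 ^ (-(2 * (n:ℝ) * t)))
        = A * bnum n * 2 ^ ((n:ℝ) + -(2 * (n:ℝ) * t)) := by
      rw [Real.rpow_add (by norm_num), Real.rpow_natCast]; ring
    rw [e]
    refine mul_le_mul_of_nonneg_left ?_ (by positivity)
    apply Real.rpow_le_rpow_of_exponent_le (by norm_num)
    have hd : ep / (40 * L) ≤ 1 := by
      rw [div_le_one (by positivity)]; linarith
    have h3 : ep / (40 * L) * ((n:ℝ) * t) ≤ 1 * ((n:ℝ) * t) :=
      mul_le_mul_of_nonneg_right hd (by positivity)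
    nlinarith
  have h3 := b1 ∅
  have h4 := b1 univ
  linarith

lemma bal_card (n : ℕ) :
    (((FS (Fin n)).filter fun c => BalOff c ∅).card : ℝ) ≤ 2 * bnum n := by
  have hch : ∀ c : Fin n → Fin n → SignType, ∃ g : Fin n → SignType, BalOff c ∅ →
      (∀ v, g v ≠ 0) ∧ ∀ v v', c v v' ≠ 0 → c v v' = g v * g v' := by
    intro c
    by_cases h : BalOff c ∅
    · obtain ⟨g, h1, h2⟩ := h
      exact ⟨g, fun _ => ⟨h1, fun v v' => h2 v (by simp) v' (by simp)⟩⟩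
    · exact ⟨fun _ => 0, fun h' => absurd h' h⟩
  choose g hg using hch
  let φ : (Fin n → Fin n → SignType) → (Fin n → Bool) × ((i : Fin n) → Fin i → Bool) :=
    fun c => (fun v => decide (g c v = 1), fun i j => decide (c i ⟨j, j.2.trans i.2⟩ ≠ 0))
  have hcard : ((FS (Fin n)).filter fun c => BalOff c ∅).card ≤
      (univ : Finset ((Fin n → Bool) × ((i : Fin n) → Fin i → Bool))).card := by
    refine card_le_card_of_injOn φ (fun _ _ => by simp) ?_
    intro c hc c' hc' heq
    simp only [mem_coe, mem_filter, FS, mem_univ, true_and] at hc hc'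
    obtain ⟨g1, g2⟩ := hg c hc.2
    obtain ⟨g1', g2'⟩ := hg c' hc'.2
    simp only [φ, Prod.mk.injEq] at heq
    have hgg : g c = g c' := by
      funext v
      have := congrFun heq.1 v
      simp only [decide_eq_decide] at this
      have a1 := g1 v
      have a2 := g1' v
      revert this a1 a2
      generalize g c v = p
      generalize g c' v = q
      revert p q
      decide
    have hlt : ∀ i j : Fin n, j < i → c i j = c' i j := by
      intro i j hij
      have := congrFun (congrFun heq.2 i) ⟨j, hij⟩
      simp only [decide_eq_decide] at this
      by_cases h0 : c i j = 0
      · rw [h0]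
        by_contra h
        exact this.2 (fun h' => h h'.symm) h0
      · rw [g2 i j h0, g2' i j (this.1 h0), hgg]
    funext i j
    rcases lt_trichotomy i j with h | h | h
    · rw [hc.1.1, hc'.1.1 i j]; exact hlt j i h
    · subst h; rw [hc.1.2.1, hc'.1.2.1]
    · exact hlt i j h
  have hc2 : (univ : Finset ((Fin n → Bool) × ((i : Fin n) → Fin i → Bool))).card
      = 2 ^ (n + n * (n - 1) / 2) := by
    rw [card_univ, Fintype.card_prod, Fintype.card_pi]
    simp only [Fintype.card_pi, Fintype.card_bool, prod_const, card_univ, Fintype.card_fin]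
    rw [Fin.prod_univ_eq_prod_range (fun i => 2 ^ i), prod_pow_eq_pow_sum, sum_range_id, pow_add]
  rw [hc2] at hcard
  have h3 : 2 ^ (n + n * (n - 1) / 2) ≤ 2 * bnum n := by
    unfold bnum
    rw [← pow_succ']
    apply Nat.pow_le_pow_right (by norm_num)
    have : n * (n + 1) = n * (n - 1) + 2 * n := by
      cases n with
      | zero => rfl
      | succ m => simp; ring
    omega
  exact_mod_cast hcard.trans h3

lemma F_bound : ∃ A : ℝ, 1 ≤ A ∧ ∀ n, ((FS (Fin n)).card : ℝ) ≤ A * bnum n := by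
  obtain ⟨g, hg, τ, hτ, N, hN⟩ := main_count
  obtain ⟨N1, hN1⟩ := exists_nat_gt (3 / g)
  obtain ⟨N2, hN2⟩ := exists_nat_gt (1 / τ)
  set M := max N (max N1 N2) with hM
  have hb : ∀ m, (1:ℝ) ≤ bnum m := by
    intro m
    have : 1 ≤ bnum m := Nat.one_le_two_pow
    exact_mod_cast this
  set A : ℝ := 4 + ∑ m ∈ range M, ((FS (Fin m)).card : ℝ) with hA
  have hA4 : 4 ≤ A := by
    have : 0 ≤ ∑ m ∈ range M, ((FS (Fin m)).card : ℝ) := sum_nonneg fun _ _ => by positivity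
    linarith
  have hAs : ∑ m ∈ range M, ((FS (Fin m)).card : ℝ) ≤ A := by linarith
  have hA0 : 0 ≤ A := by linarith
  clear_value A
  clear hA
  refine ⟨A, by linarith, fun n => ?_⟩
  induction n using Nat.strong_induction_on with
  | _ n ih =>
    by_cases hn : n < M
    · have h1 : ((FS (Fin n)).card : ℝ) ≤ ∑ m ∈ range M, ((FS (Fin m)).card : ℝ) :=
        single_le_sum (f := fun m => ((FS (Fin m)).card : ℝ)) (fun _ _ => by positivity)
          (mem_range.2 hn)
      exact (h1.trans hAs).trans (le_mul_of_one_le_right hA0 (hb n))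
    · push Not at hn
      have hn0 : N ≤ n := (le_max_left _ _).trans hn
      have hn1 : (N1:ℝ) ≤ n := by
        exact_mod_cast ((le_max_left _ _).trans (le_max_right _ _)).trans hn
      have hn2 : (N2:ℝ) ≤ n := by
        exact_mod_cast ((le_max_right _ _).trans (le_max_right _ _)).trans hn
      have h1 := hN n hn0 1 le_rfl (by
        have := (div_lt_iff₀ hτ).1 (hN2.trans_le hn2)
        push_cast; linarith) A (by linarith) ih
      have h3g := (div_lt_iff₀ hg).1 (hN1.trans_le hn1)
      have h2 : (2:ℝ) ^ (-(g * n * (1:ℕ))) ≤ 1/8 := by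
        have : (2:ℝ) ^ (-3 : ℝ) = 1/8 := by
          rw [Real.rpow_neg (by norm_num)]; norm_num
        rw [← this]
        apply Real.rpow_le_rpow_of_exponent_le (by norm_num)
        push_cast
        linarith
      have hsub : FS (Fin n) ⊆ Sf n 1 ∪ (FS (Fin n)).filter fun c => BalOff c ∅ := by
        intro c hc
        simp only [mem_union, Sf, mem_filter, hc, true_and]
        by_contra hcon
        push Not at hcon
        obtain ⟨⟨D, hD, hD1⟩, h⟩ := hcon
        have : D = ∅ := by
          rw [← card_eq_zero]; omega
        exact h (this ▸ hD)
      have h3 : ((FS (Fin n)).card : ℝ) ≤ (Sf n 1).card +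
          ((FS (Fin n)).filter fun c => BalOff c ∅).card := by
        exact_mod_cast (card_le_card hsub).trans (card_union_le _ _)
      have h4 := bal_card n
      have h5 := hb n
      have h6 : 3 * A * bnum n * 2 ^ (-(g * n * (1:ℕ))) ≤ 3 * A * bnum n * (1/8) :=
        mul_le_mul_of_nonneg_left h2
          (mul_nonneg (mul_nonneg (by norm_num) hA0) (zero_le_one.trans h5))
      have h7 : 4 * (bnum n : ℝ) ≤ A * bnum n :=
        mul_le_mul_of_nonneg_right hA4 (zero_le_one.trans h5)
      have h8 : 0 ≤ A * (bnum n : ℝ) := mul_nonneg hA0 (zero_le_one.trans h5)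
      refine h3.trans ((add_le_add (h1.trans h6) h4).trans ?_)
      linarith

/-- Sign matrix of a colored graph. -/
def sgn {n : ℕ} (G : ColoredGraph n) (x y : Fin n) : SignType :=
  if G.red.Adj x y then 1 else if G.blue.Adj x y then -1 else 0

lemma sgn_one {n : ℕ} (G : ColoredGraph n) (x y : Fin n) : sgn G x y = 1 ↔ G.red.Adj x y := by
  unfold sgn
  split_ifs with h1 h2
  · simp [h1]
  · simp only [h1, iff_false]
  · simp only [h1, iff_false]

lemma sgn_neg {n : ℕ} (G : ColoredGraph n) (x y : Fin n) : sgn G x y = -1 ↔ G.blue.Adj x y := by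
  unfold sgn
  split_ifs with h1 h2
  · have : ¬ G.blue.Adj x y := fun h => G.disj x y ⟨h1, h⟩
    simp only [this, iff_false]
  · simp [h2]
  · simp only [h2, iff_false]

lemma sgn_inj {n : ℕ} : Function.Injective (sgn : ColoredGraph n → _) := by
  intro G G' h
  have hr : G.red = G'.red := by
    ext x y
    rw [← sgn_one, ← sgn_one, h]
  have hb : G.blue = G'.blue := by
    ext x y
    rw [← sgn_neg, ← sgn_neg, h]
  cases G
  cases G'
  simp only at hr hb
  subst hr hb
  rfl

lemma sgn_OK {n : ℕ} (G : ColoredGraph n) (hG : G.OBTF) : OK (sgn G) := by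
  refine ⟨fun x y => ?_, fun x => ?_, fun x y z => ?_⟩
  · simp [sgn, G.red.adj_comm x y, G.blue.adj_comm x y]
  · simp [sgn]
  · have hadj : ∀ x y, sgn G x y ≠ 0 → G.Adj x y := by
      intro x y h
      rcases st (sgn G x y) with h' | h' | h'
      · exact absurd h' h
      · exact Or.inl ((sgn_one G x y).1 h')
      · exact Or.inr ((sgn_neg G x y).1 h')
    have hbl : ∀ x y, G.blueInd x y = if sgn G x y = -1 then 1 else 0 := by
      intro x y
      simp only [ColoredGraph.blueInd, sgn_neg]
    intro hcon
    have h1 : sgn G x y ≠ 0 := by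
      intro h; rw [h] at hcon; simp at hcon
    have h2 : sgn G y z ≠ 0 := by
      intro h; rw [h] at hcon; simp at hcon
    have h3 : sgn G x z ≠ 0 := by
      intro h; rw [h] at hcon; simp at hcon
    have h4 := hG x y z (hadj _ _ h1) (hadj _ _ h2) (hadj _ _ h3)
    rw [hbl, hbl, hbl] at h4
    revert h1 h2 h3 h4 hcon
    generalize sgn G x y = p
    generalize sgn G y z = q
    generalize sgn G x z = r
    intro hcon h1 h2 h3 h4
    rcases st p with rfl | rfl | rfl <;> rcases st q with rfl | rfl | rfl <;>
      rcases st r with rfl | rfl | rfl <;> revert h4 hcon h1 h2 h3 <;> decide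

lemma sgn_bal {n : ℕ} (G : ColoredGraph n) (D : Finset (Fin n)) (h : BalOff (sgn G) D) :
    G.kappa ≤ D.card := by
  apply Nat.sInf_le
  refine ⟨(D : Set (Fin n)), Set.ncard_coe_finset D, ?_⟩
  obtain ⟨g, h1, h2⟩ := h
  refine ⟨{v | v ∉ D ∧ g v = 1}, fun v hv => by simpa using hv.1, ?_⟩
  intro x hx y hy
  have hx' : x ∉ D := by simpa using hx
  have hy' : y ∉ D := by simpa using hy
  simp only [Set.mem_setOf_eq, hx', hy', not_false_eq_true, true_and]
  have h3 := h2 x hx' y hy'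
  have gx := h1 x
  have gy := h1 y
  constructor
  · intro hb
    rw [← sgn_neg] at hb
    rw [hb] at h3
    have h4 := h3 (by decide)
    revert h4 gx gy
    generalize g x = p
    generalize g y = q
    revert p q
    decide
  · intro hb
    rw [← sgn_one] at hb
    rw [hb] at h3
    have h4 := h3 (by decide)
    revert h4 gx gy
    generalize g x = p
    generalize g y = q
    revert p q
    decide

lemma transfer (n t : ℕ) : ({G ∈ obtfSet n | t ≤ G.kappa}.ncard : ℝ) ≤ (Sf n t).card := by
  have : {G ∈ obtfSet n | t ≤ G.kappa}.ncard ≤ (Sf n t : Set (Fin n → Fin n → SignType)).ncard := by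
    refine Set.ncard_le_ncard_of_injOn sgn ?_ (fun _ _ _ _ h => sgn_inj h) (Finset.finite_toSet _)
    rintro G ⟨hG, ht⟩
    simp only [mem_coe, Sf, FS, mem_filter, mem_univ, true_and]
    exact ⟨sgn_OK G hG, fun D hD => ht.trans (sgn_bal G D hD)⟩
  rw [Set.ncard_coe_finset] at this
  exact_mod_cast this

lemma log_small (τ : ℝ) (hτ : 0 < τ) : ∃ N : ℕ, ∀ n : ℕ, N ≤ n →
    (⌈1 * Real.logb 2 n⌉₊ : ℝ) ≤ τ * n := by
  have h1 : (fun x : ℝ => Real.log x) =o[atTop] fun x => x := Real.isLittleO_log_id_atTop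
  have hl : 0 < Real.log 2 := Real.log_pos (by norm_num)
  have h2 := (h1.bound (show 0 < τ / 2 * Real.log 2 by positivity))
  have h3 := tendsto_natCast_atTop_atTop.eventually h2
  obtain ⟨N, hN⟩ := eventually_atTop.1 h3
  obtain ⟨N1, hN1⟩ := exists_nat_gt (2 / τ)
  refine ⟨max (max N N1) 1, fun n hn => ?_⟩
  have hn1 : 1 ≤ n := (le_max_right _ _).trans hn
  have a := hN n (((le_max_left _ _).trans (le_max_left _ _)).trans hn)
  have b : (N1:ℝ) ≤ n := by exact_mod_cast ((le_max_right _ _).trans (le_max_left _ _)).trans hn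
  have hnr : (1:ℝ) ≤ n := by exact_mod_cast hn1
  have hlog : 0 ≤ Real.log n := Real.log_nonneg hnr
  rw [Real.norm_of_nonneg hlog, Real.norm_of_nonneg (by positivity)] at a
  have hlb : Real.logb 2 n ≤ τ / 2 * n := by
    unfold Real.logb
    rw [div_le_iff₀ hl]
    linarith
  have hlb0 : 0 ≤ 1 * Real.logb 2 n := by
    unfold Real.logb; positivity
  have c := Nat.ceil_lt_add_one hlb0
  have d := (div_lt_iff₀ hτ).1 (hN1.trans_le b)
  linarith

end OB

/-- Theorem 3.8: there are constants `δ, C > 0` such that for large `n` and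
`1 ≤ t ≤ ⌈C log₂ n⌉`, `|{G ∈ 𝓕(n) : κ(G) ≥ t}| < 2^{-δnt} b(n)`. -/
theorem kappa_large_count :
    ∃ δ : ℝ, 0 < δ ∧ ∃ C : ℝ, 0 < C ∧ ∃ N : ℕ, ∀ n : ℕ, N ≤ n →
      ∀ t : ℕ, 1 ≤ t → t ≤ ⌈C * Real.logb 2 n⌉₊ →
        ({G ∈ obtfSet n | t ≤ G.kappa}.ncard : ℝ) <
          (2 : ℝ) ^ (-(δ * n * t)) * bnum n := by
  obtain ⟨g, hg, τ, hτ, N, hN⟩ := OB.main_count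
  obtain ⟨A, hA, hF⟩ := OB.F_bound
  obtain ⟨N1, hN1⟩ := OB.log_small τ hτ
  obtain ⟨N2, hN2⟩ := exists_nat_gt (Real.logb 2 (3 * A) / (g / 2))
  refine ⟨g / 2, by positivity, 1, one_pos, max N (max N1 N2), fun n hn t ht htl => ?_⟩
  have hn0 : N ≤ n := (le_max_left _ _).trans hn
  have hn1 : N1 ≤ n := ((le_max_left _ _).trans (le_max_right _ _)).trans hn
  have hn2 : (N2:ℝ) ≤ n := by
    exact_mod_cast ((le_max_right _ _).trans (le_max_right _ _)).trans hn
  have htn : (t:ℝ) ≤ τ * n := (by exact_mod_cast htl : (t:ℝ) ≤ (⌈1 * Real.logb 2 n⌉₊ : ℝ)).trans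
    (hN1 n hn1)
  have h1 := (OB.transfer n t).trans (hN n hn0 t ht htn A (by linarith) fun m _ => hF m)
  refine h1.trans_lt ?_
  have htr : (1:ℝ) ≤ t := by exact_mod_cast ht
  have h2 := (div_lt_iff₀ (by positivity)).1 (hN2.trans_le hn2)
  have h3 : 3 * A < 2 ^ (g / 2 * n * t) := by
    rw [← Real.logb_lt_iff_lt_rpow (by norm_num) (by positivity)]
    have : (n:ℝ) * (g / 2) ≤ g / 2 * n * t := by
      rw [mul_comm (n:ℝ)]
      exact le_mul_of_one_le_right (by positivity) htr
    linarith
  have hb : (0:ℝ) < bnum n := by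
    have : 0 < bnum n := by unfold bnum; positivity
    exact_mod_cast this
  have e : (2:ℝ) ^ (-(g / 2 * n * t)) = 2 ^ (g / 2 * n * t) * 2 ^ (-(g * n * t)) := by
    rw [← Real.rpow_add (by norm_num)]
    congr 1
    ring
  rw [e]
  have hp : (0:ℝ) < bnum n * 2 ^ (-(g * n * t)) := by positivity
  calc 3 * A * bnum n * 2 ^ (-(g * n * t)) = 3 * A * (bnum n * 2 ^ (-(g * n * t))) := by ring
    _ < 2 ^ (g / 2 * n * t) * (bnum n * 2 ^ (-(g * n * t))) := mul_lt_mul_of_pos_right h3 hp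
    _ = _ := by ring
end
end
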